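/- arXiv:2510.23599 — 3 statements merged into one kernel-verified Lean document; each statement's English description precedes it below -/
import Mathlib

section
/- Let ω = (ω₁, ω₂) ∈ ℝ² with ω ≠ 0, set ω⊥ = (ω₂, −ω₁), and let s₁, s₂ > 1/2 satisfy 1/s₁ + 1/s₂ < 2. For a trigonometric polynomial h on 𝕋² with coefficients ĥ, set N(h) = (Σ_{n∈ℤ²} (1+(ω·n)²)^{s₁} |ĥ(n)|²)^{1/2} + (Σ_{n∈ℤ²} (1+(ω⊥·n)²)^{s₂} |ĥ(n)|²)^{1/2}. Then there exist constants C, C' (depending only on ω, s₁, s₂) such that for all trigonometric polynomials f, g on 𝕋²: N(f·g) ≤ C·( N(f)·‖g‖_{L^∞} + ‖f‖_{L^∞}·N(g) ) ≤ C'·N(f)·N(g). -/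
open scoped Real

/-- The trigonometric polynomial on `𝕋²` with Fourier coefficients `c : ℤ² → ℂ`. -/
noncomputable def trigSum (c : ℤ × ℤ → ℂ) (x : ℝ × ℝ) : ℂ :=
  ∑' n : ℤ × ℤ, c n * Complex.exp (2 * Real.pi * Complex.I *
    (((n.1 : ℝ) * x.1 + (n.2 : ℝ) * x.2 : ℝ) : ℂ))

/-- The anisotropic Sobolev norm `‖·‖_{H^{s₁,s₂}_ω}` of a coefficient sequence,
with `ω⊥ = (ω₂, −ω₁)`. -/
noncomputable def anisoNorm (ω : ℝ × ℝ) (s₁ s₂ : ℝ) (c : ℤ × ℤ → ℂ) : ℝ :=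
  (∑' n : ℤ × ℤ,
      (1 + (ω.1 * (n.1 : ℝ) + ω.2 * (n.2 : ℝ)) ^ 2) ^ s₁ * ‖c n‖ ^ 2) ^ ((1 : ℝ) / 2) +
  (∑' n : ℤ × ℤ,
      (1 + (ω.2 * (n.1 : ℝ) - ω.1 * (n.2 : ℝ)) ^ 2) ^ s₂ * ‖c n‖ ^ 2) ^ ((1 : ℝ) / 2)

/-- The sup norm `‖f‖_{L^∞} = sup_{x∈ℝ²} |f(x)|` of a trigonometric polynomial. -/
noncomputable def supNorm (c : ℤ × ℤ → ℂ) : ℝ := ⨆ x : ℝ × ℝ, ‖trigSum c x‖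

/-- The Fourier coefficients of the product of two trigonometric polynomials
(convolution of the coefficient sequences). -/
noncomputable def convCoef (f g : ℤ × ℤ → ℂ) (n : ℤ × ℤ) : ℂ :=
  ∑' a : ℤ × ℤ, f a * g (n - a)

open MeasureTheory

/-- The character `e(n·x)`. -/
noncomputable def chE (n : ℤ × ℤ) (x : ℝ × ℝ) : ℂ :=
  Complex.exp (2 * Real.pi * Complex.I * (((n.1 : ℝ) * x.1 + (n.2 : ℝ) * x.2 : ℝ) : ℂ))

lemma chE_add (m n : ℤ × ℤ) (x : ℝ × ℝ) : chE (m + n) x = chE m x * chE n x := by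
  unfold chE
  rw [← Complex.exp_add]
  congr 1
  push_cast [Prod.fst_add, Prod.snd_add]
  ring

lemma norm_chE (n : ℤ × ℤ) (x : ℝ × ℝ) : ‖chE n x‖ = 1 := by
  unfold chE
  have : (2 * Real.pi * Complex.I * (((n.1 : ℝ) * x.1 + (n.2 : ℝ) * x.2 : ℝ) : ℂ))
    = ((2 * Real.pi * ((n.1 : ℝ) * x.1 + (n.2 : ℝ) * x.2) : ℝ) : ℂ) * Complex.I := by
    push_cast; ring
  rw [this, Complex.norm_exp_ofReal_mul_I]

lemma continuous_chE (n : ℤ × ℤ) : Continuous (chE n) := by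
  unfold chE
  fun_prop

lemma trigSum_eq_tsum (c : ℤ × ℤ → ℂ) (x : ℝ × ℝ) : trigSum c x = ∑' n, c n * chE n x := rfl

lemma summable_fs {E : Type*} [AddCommMonoid E] [TopologicalSpace E] {c : ℤ × ℤ → ℂ}
    (hc : (Function.support c).Finite) (u : ℤ × ℤ → E) (hu : ∀ n, c n = 0 → u n = 0) :
    Summable u :=
  summable_of_hasFiniteSupport (hc.subset fun n hn h => hn (hu n h))

lemma trigSum_eq_sum {c : ℤ × ℤ → ℂ} (hc : (Function.support c).Finite) (x : ℝ × ℝ) :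
    trigSum c x = ∑ n ∈ hc.toFinset, c n * chE n x := by
  rw [trigSum_eq_tsum]
  apply tsum_eq_sum
  intro n hn
  simp at hn
  simp [hn]

lemma continuous_trigSum {c : ℤ × ℤ → ℂ} (hc : (Function.support c).Finite) :
    Continuous (trigSum c) := by
  have : trigSum c = fun x => ∑ n ∈ hc.toFinset, c n * chE n x := by
    ext x; exact trigSum_eq_sum hc x
  rw [this]
  exact continuous_finsetSum _ fun n _ => continuous_const.mul (continuous_chE n)

lemma norm_trigSum_le_tsum {c : ℤ × ℤ → ℂ} (hc : (Function.support c).Finite) (x : ℝ × ℝ) :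
    ‖trigSum c x‖ ≤ ∑' n, ‖c n‖ := by
  rw [trigSum_eq_tsum]
  refine (norm_tsum_le_tsum_norm ?_).trans (le_of_eq ?_)
  · exact summable_fs hc _ (by intro n h; simp [h])
  · simp [norm_chE]

lemma bddAbove_trig {c : ℤ × ℤ → ℂ} (hc : (Function.support c).Finite) :
    BddAbove (Set.range fun x => ‖trigSum c x‖) := by
  refine ⟨∑' n, ‖c n‖, ?_⟩
  rintro _ ⟨x, rfl⟩
  exact norm_trigSum_le_tsum hc x

lemma norm_trigSum_le {c : ℤ × ℤ → ℂ} (hc : (Function.support c).Finite) (x : ℝ × ℝ) :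
    ‖trigSum c x‖ ≤ supNorm c := le_ciSup (bddAbove_trig hc) x

lemma supNorm_nonneg (c : ℤ × ℤ → ℂ) : 0 ≤ supNorm c :=
  Real.iSup_nonneg fun _ => norm_nonneg _

lemma support_conv {f g : ℤ × ℤ → ℂ} (hf : (Function.support f).Finite)
    (hg : (Function.support g).Finite) : (Function.support (convCoef f g)).Finite := by
  refine (hf.add hg).subset ?_
  intro n hn
  by_contra h
  apply hn
  unfold convCoef
  convert tsum_zero with a
  by_contra h2
  apply h
  refine ⟨a, ?_, n - a, ?_, by simp⟩
  · exact fun h3 => h2 (by simp [h3])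
  · exact fun h3 => h2 (by simp [h3])

lemma summable_conv {f : ℤ × ℤ → ℂ} (hf : (Function.support f).Finite)
    (g : ℤ × ℤ → ℂ) (n : ℤ × ℤ) : Summable fun a => f a * g (n - a) :=
  summable_fs hf _ (by intro n h; simp [h])

lemma trigSum_conv {f g : ℤ × ℤ → ℂ} (hf : (Function.support f).Finite)
    (hg : (Function.support g).Finite) (x : ℝ × ℝ) :
    trigSum (convCoef f g) x = trigSum f x * trigSum g x := by
  have h1 : Summable fun a => ‖f a * chE a x‖ := summable_fs hf _ (by intro n h; simp [h])
  have h2 : Summable fun a => ‖g a * chE a x‖ := summable_fs hg _ (by intro n h; simp [h])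
  rw [trigSum_eq_tsum f, trigSum_eq_tsum g, tsum_mul_tsum_of_summable_norm h1 h2]
  have h3 := summable_mul_of_summable_norm h1 h2
  let e : (ℤ × ℤ) × (ℤ × ℤ) ≃ (ℤ × ℤ) × (ℤ × ℤ) :=
    { toFun := fun p => (p.2, p.1 - p.2)
      invFun := fun p => (p.1 + p.2, p.1)
      left_inv := by intro p; simp
      right_inv := by intro p; simp }
  rw [← e.tsum_eq, Summable.tsum_prod]
  · rw [trigSum_eq_tsum]
    refine tsum_congr fun n => ?_
    unfold convCoef
    rw [← tsum_mul_right]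
    refine tsum_congr fun a => ?_
    simp only [e, Equiv.coe_fn_mk]
    have : chE n x = chE a x * chE (n - a) x := by rw [← chE_add]; simp
    rw [this]; ring
  · exact (e.summable_iff (f := fun z : (ℤ × ℤ) × (ℤ × ℤ) =>
      f z.1 * chE z.1 x * (g z.2 * chE z.2 x))).2 h3

/-- Lebesgue measure on the unit square. -/
noncomputable def sqM : Measure (ℝ × ℝ) :=
  (volume.restrict (Set.Ioc (0:ℝ) 1)).prod (volume.restrict (Set.Ioc (0:ℝ) 1))

instance : IsFiniteMeasure sqM := by unfold sqM; infer_instance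

lemma integral_ch1 (k : ℤ) : ∫ x in Set.Ioc (0:ℝ) 1,
    Complex.exp (2 * Real.pi * Complex.I * (k : ℂ) * (x : ℂ)) = if k = 0 then 1 else 0 := by
  rw [← intervalIntegral.integral_of_le zero_le_one]
  split_ifs with h
  · simp [h]
  · have : (2 * Real.pi * Complex.I * (k : ℂ)) ≠ 0 := by
      simp [h, Real.pi_ne_zero]
    rw [integral_exp_mul_complex this]
    have h2 : Complex.exp (2 * Real.pi * Complex.I * (k : ℂ)) = 1 := by
      rw [Complex.exp_eq_one_iff]
      exact ⟨k, by ring⟩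
    simp [h2]

lemma integral_chE (n : ℤ × ℤ) : ∫ x, chE n x ∂sqM = if n = 0 then 1 else 0 := by
  have h : ∀ x : ℝ × ℝ, chE n x =
      Complex.exp (2 * Real.pi * Complex.I * (n.1 : ℂ) * (x.1 : ℂ)) *
      Complex.exp (2 * Real.pi * Complex.I * (n.2 : ℂ) * (x.2 : ℂ)) := by
    intro x
    unfold chE
    rw [← Complex.exp_add]
    congr 1
    push_cast
    ring
  simp_rw [h]
  unfold sqM
  rw [integral_prod_mul (fun x : ℝ => Complex.exp (2 * Real.pi * Complex.I * (n.1 : ℂ) * (x : ℂ)))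
    (fun x : ℝ => Complex.exp (2 * Real.pi * Complex.I * (n.2 : ℂ) * (x : ℂ))),
    integral_ch1, integral_ch1]
  rcases n with ⟨a, b⟩
  by_cases ha : a = 0 <;> by_cases hb : b = 0 <;> simp [ha, hb]

lemma conj_chE (n : ℤ × ℤ) (x : ℝ × ℝ) : (starRingEnd ℂ) (chE n x) = chE (-n) x := by
  unfold chE
  rw [← Complex.exp_conj]
  congr 1
  simp only [map_mul, Complex.conj_I, Complex.conj_ofReal, map_ofNat]
  push_cast [Prod.fst_neg, Prod.snd_neg]
  ring

lemma parseval {c : ℤ × ℤ → ℂ} (hc : (Function.support c).Finite) :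
    ∫ x, ‖trigSum c x‖ ^ 2 ∂sqM = ∑' n, ‖c n‖ ^ 2 := by
  have h0 : ∑' n, ‖c n‖ ^ 2 = ∑ n ∈ hc.toFinset, ‖c n‖ ^ 2 := by
    apply tsum_eq_sum
    intro n hn
    simp at hn
    simp [hn]
  rw [h0]
  apply Complex.ofReal_injective
  rw [← integral_complex_ofReal]
  have h1 : ∀ x, ((‖trigSum c x‖ ^ 2 : ℝ) : ℂ) = ∑ m ∈ hc.toFinset, ∑ n ∈ hc.toFinset,
      (c m * (starRingEnd ℂ) (c n)) * chE (m - n) x := by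
    intro x
    rw [Complex.ofReal_pow, ← Complex.mul_conj', trigSum_eq_sum hc, map_sum, Finset.sum_mul_sum]
    refine Finset.sum_congr rfl fun m _ => Finset.sum_congr rfl fun n _ => ?_
    rw [map_mul, conj_chE, sub_eq_add_neg, chE_add]
    ring
  have hi : ∀ n, Integrable (chE n) sqM := fun n =>
    Integrable.of_bound (continuous_chE n).aestronglyMeasurable 1
      (Filter.Eventually.of_forall fun x => (norm_chE n x).le)
  refine (integral_congr_ae (Filter.Eventually.of_forall h1)).trans ?_
  rw [integral_finsetSum _ fun m _ => integrable_finsetSum _ fun n _ => (hi _).const_mul _]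
  rw [Complex.ofReal_sum]
  refine Finset.sum_congr rfl fun m hm => ?_
  rw [integral_finsetSum _ fun n _ => (hi _).const_mul _]
  simp_rw [integral_const_mul, integral_chE, sub_eq_zero]
  simp only [mul_ite, mul_one, mul_zero]
  rw [Finset.sum_ite_eq, if_pos hm, Complex.mul_conj']
  norm_cast

lemma integrable_trig_sq {c : ℤ × ℤ → ℂ} (hc : (Function.support c).Finite) :
    Integrable (fun x => ‖trigSum c x‖ ^ 2) sqM := by
  refine Integrable.of_bound ((continuous_trigSum hc).norm.pow 2).aestronglyMeasurable
    (supNorm c ^ 2) (Filter.Eventually.of_forall fun x => ?_)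
  rw [Real.norm_of_nonneg (by positivity)]
  exact pow_le_pow_left₀ (norm_nonneg _) (norm_trigSum_le hc x) 2

lemma l2_conv_right {f g : ℤ × ℤ → ℂ} (hf : (Function.support f).Finite)
    (hg : (Function.support g).Finite) {M : ℝ} (hM : ∀ x, ‖trigSum g x‖ ≤ M) :
    ∑' n, ‖convCoef f g n‖ ^ 2 ≤ M ^ 2 * ∑' n, ‖f n‖ ^ 2 := by
  rw [← parseval (support_conv hf hg), ← parseval hf, ← integral_const_mul]
  refine integral_mono (integrable_trig_sq (support_conv hf hg))
    ((integrable_trig_sq hf).const_mul _) fun x => ?_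
  simp only
  rw [trigSum_conv hf hg, norm_mul, mul_pow, mul_comm]
  gcongr
  exact hM x

lemma l2_conv_left {f g : ℤ × ℤ → ℂ} (hf : (Function.support f).Finite)
    (hg : (Function.support g).Finite) {M : ℝ} (hM : ∀ x, ‖trigSum f x‖ ≤ M) :
    ∑' n, ‖convCoef f g n‖ ^ 2 ≤ M ^ 2 * ∑' n, ‖g n‖ ^ 2 := by
  rw [← parseval (support_conv hf hg), ← parseval hg, ← integral_const_mul]
  refine integral_mono (integrable_trig_sq (support_conv hf hg))
    ((integrable_trig_sq hg).const_mul _) fun x => ?_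
  simp only
  rw [trigSum_conv hf hg, norm_mul, mul_pow]
  gcongr
  exact hM x

open FourierTransform in
lemma exists_cutoff : ∃ (ψ : ℝ → ℝ) (K : ℝ → ℂ), Integrable K ∧ (∀ x, 0 ≤ ψ x) ∧ (∀ x, ψ x ≤ 1) ∧
    (∀ x, |x| ≤ 1 → ψ x = 1) ∧ (∀ x, 2 ≤ |x| → ψ x = 0) ∧
    ∀ x : ℝ, (ψ x : ℂ) = ∫ v : ℝ, Complex.exp (2 * Real.pi * Complex.I * ((v * x : ℝ) : ℂ)) * K v := by
  let ψ : ContDiffBump (0:ℝ) := ⟨1, 2, by norm_num, by norm_num⟩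
  have hcs : HasCompactSupport (fun x : ℝ => ((ψ x : ℝ) : ℂ)) :=
    ψ.hasCompactSupport.comp_left (g := fun r : ℝ => (r : ℂ)) (by simp)
  have hsm : ContDiff ℝ ((⊤ : ℕ∞) : WithTop ℕ∞) (fun x : ℝ => ((ψ x : ℝ) : ℂ)) :=
    Complex.ofRealCLM.contDiff.comp ψ.contDiff
  let Ψ : SchwartzMap ℝ ℂ := hcs.toSchwartzMap hsm
  refine ⟨ψ, ⇑(𝓕 Ψ : SchwartzMap ℝ ℂ), (𝓕 Ψ : SchwartzMap ℝ ℂ).integrable, fun x => ψ.nonneg, fun x => ψ.le_one, ?_, ?_, ?_⟩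
  · intro x hx
    exact ψ.one_of_mem_closedBall (by simpa [ψ] using hx)
  · intro x hx
    exact ψ.zero_of_le_dist (by simpa [ψ] using hx)
  · intro x
    have h1 : 𝓕⁻ (𝓕 Ψ) = Ψ := FourierPair.fourierInv_fourier_eq Ψ
    have h2 : (𝓕⁻ (𝓕 Ψ)) x = (ψ x : ℂ) := by rw [h1]; rfl
    rw [← h2, SchwartzMap.fourierInv_coe, Real.fourierInv_eq']
    refine integral_congr_ae (Filter.Eventually.of_forall fun v => ?_)
    simp only [smul_eq_mul]
    congr 2
    simp
    ring

/-- Multiplier applied to coefficients. -/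
noncomputable def lowP (ψ : ℝ → ℝ) (a b r : ℝ) (f : ℤ × ℤ → ℂ) (n : ℤ × ℤ) : ℂ :=
  (ψ (r * (a * n.1 + b * n.2)) : ℂ) * f n

lemma support_lowP {ψ : ℝ → ℝ} {a b r : ℝ} {f : ℤ × ℤ → ℂ} (hf : (Function.support f).Finite) :
    (Function.support (lowP ψ a b r f)).Finite :=
  hf.subset fun n hn h => hn (by simp [lowP, h])

lemma trig_lowP_le {ψ : ℝ → ℝ} {K : ℝ → ℂ} (hK : Integrable K)
    (hψ : ∀ x : ℝ, (ψ x : ℂ) =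
      ∫ v : ℝ, Complex.exp (2 * Real.pi * Complex.I * ((v * x : ℝ) : ℂ)) * K v)
    (a b r : ℝ) {f : ℤ × ℤ → ℂ} (hf : (Function.support f).Finite) (x : ℝ × ℝ) :
    ‖trigSum (lowP ψ a b r f) x‖ ≤ (∫ v, ‖K v‖) * supNorm f := by
  have key : trigSum (lowP ψ a b r f) x =
      ∫ v, trigSum f (x.1 + v * r * a, x.2 + v * r * b) * K v := by
    have h1 : trigSum (lowP ψ a b r f) x =
        ∑ n ∈ hf.toFinset, lowP ψ a b r f n * chE n x := by
      rw [trigSum_eq_tsum]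
      apply tsum_eq_sum
      intro n hn
      simp at hn
      simp [hn, lowP]
    rw [h1]
    simp_rw [trigSum_eq_sum hf, Finset.sum_mul]
    rw [integral_finsetSum]
    · refine Finset.sum_congr rfl fun n _ => ?_
      unfold lowP
      rw [hψ, mul_assoc, ← integral_mul_const]
      refine integral_congr_ae (Filter.Eventually.of_forall fun v => ?_)
      simp only [chE]
      have : Complex.exp (2 * Real.pi * Complex.I *
          (((n.1 : ℝ) * (x.1 + v * r * a) + (n.2 : ℝ) * (x.2 + v * r * b) : ℝ) : ℂ)) =
          Complex.exp (2 * Real.pi * Complex.I * ((v * (r * (a * n.1 + b * n.2)) : ℝ) : ℂ)) *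
          Complex.exp (2 * Real.pi * Complex.I *
          (((n.1 : ℝ) * x.1 + (n.2 : ℝ) * x.2 : ℝ) : ℂ)) := by
        rw [← Complex.exp_add]
        congr 1
        push_cast
        ring
      rw [this]
      ring
    · intro n _
      refine Integrable.bdd_mul hK (c := ‖f n‖) ?_ ?_
      · refine Continuous.aestronglyMeasurable ?_
        exact continuous_const.mul ((continuous_chE n).comp (by fun_prop))
      · exact Filter.Eventually.of_forall fun v => by simp [norm_chE]
  rw [key, mul_comm, ← integral_const_mul]
  refine norm_integral_le_of_norm_le (hK.norm.const_mul _)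
    (Filter.Eventually.of_forall fun v => ?_)
  rw [norm_mul]
  gcongr
  exact norm_trigSum_le hf _

lemma tail_le {ψ : ℝ → ℝ} {K : ℝ → ℂ} (hK : Integrable K)
    (h0 : ∀ x, 0 ≤ ψ x) (h1 : ∀ x, ψ x ≤ 1)
    (h2 : ∀ x, |x| ≤ 1 → ψ x = 1) (h3 : ∀ x, 2 ≤ |x| → ψ x = 0)
    (hψ : ∀ x : ℝ, (ψ x : ℂ) =
      ∫ v : ℝ, Complex.exp (2 * Real.pi * Complex.I * ((v * x : ℝ) : ℂ)) * K v)
    (a b R : ℝ) (hR : 0 < R) {f g : ℤ × ℤ → ℂ} (hf : (Function.support f).Finite)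
    (hg : (Function.support g).Finite) :
    ∑' n : ℤ × ℤ, (if R ≤ |a * n.1 + b * n.2| then 1 else 0) * ‖convCoef f g n‖ ^ 2 ≤
      2 * supNorm g ^ 2 *
        ∑' n : ℤ × ℤ, (if R ≤ 4 * |a * n.1 + b * n.2| then 1 else 0) * ‖f n‖ ^ 2 +
      2 * ((∫ v, ‖K v‖) * supNorm f) ^ 2 *
        ∑' n : ℤ × ℤ, (if R ≤ 4 * |a * n.1 + b * n.2| then 1 else 0) * ‖g n‖ ^ 2 := by
  set Sf := lowP ψ a b (4 / R) f with hSf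
  set Sg := lowP ψ a b (4 / R) g with hSg
  have fSf : (Function.support Sf).Finite := support_lowP hf
  have fSg : (Function.support Sg).Finite := support_lowP hg
  have fdf : (Function.support (f - Sf)).Finite :=
    hf.subset fun n hn h => hn (by simp [hSf, lowP, h])
  have fdg : (Function.support (g - Sg)).Finite :=
    hg.subset fun n hn h => hn (by simp [hSg, lowP, h])
  have hd : ∀ (h : ℤ × ℤ → ℂ) (n : ℤ × ℤ), ‖(h - lowP ψ a b (4 / R) h) n‖ ^ 2 ≤
      (if R ≤ 4 * |a * n.1 + b * n.2| then 1 else 0) * ‖h n‖ ^ 2 := by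
    intro h n
    have e : (h - lowP ψ a b (4 / R) h) n =
        ((1 - ψ (4 / R * (a * n.1 + b * n.2)) : ℝ) : ℂ) * h n := by
      simp [lowP]; ring
    rw [e, norm_mul, Complex.norm_real, mul_pow]
    gcongr
    split_ifs with hh
    · rw [Real.norm_of_nonneg (by linarith [h1 (4 / R * (a * n.1 + b * n.2))])]
      have := h0 (4 / R * (a * n.1 + b * n.2))
      have := h1 (4 / R * (a * n.1 + b * n.2))
      nlinarith
    · rw [h2]
      · simp
      · rw [abs_mul, abs_of_pos (by positivity), div_mul_eq_mul_div, div_le_one hR]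
        linarith
  have hdec : ∀ n : ℤ × ℤ, R ≤ |a * n.1 + b * n.2| →
      convCoef f g n = convCoef (f - Sf) g n + convCoef Sf (g - Sg) n := by
    intro n hn
    unfold convCoef
    rw [← Summable.tsum_add (summable_conv fdf _ _) (summable_conv fSf _ _)]
    refine tsum_congr fun m => ?_
    have hz : Sf m * Sg (n - m) = 0 := by
      by_contra hne
      have c1 : |4 / R * (a * m.1 + b * m.2)| < 2 := by
        by_contra hc
        apply hne
        simp [hSf, lowP, h3 _ (not_lt.1 hc)]
      have c2 : |4 / R * (a * (n - m).1 + b * (n - m).2)| < 2 := by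
        by_contra hc
        apply hne
        simp only [hSg, lowP, h3 _ (not_lt.1 hc)]
        simp
      rw [abs_mul, abs_of_pos (by positivity), div_mul_eq_mul_div, div_lt_iff₀ hR] at c1 c2
      have c3 := abs_add_le (a * (m.1 : ℝ) + b * m.2) (a * ((n - m).1 : ℝ) + b * (n - m).2)
      have c4 : (a * (m.1 : ℝ) + b * m.2) + (a * ((n - m).1 : ℝ) + b * (n - m).2)
          = a * n.1 + b * n.2 := by
        push_cast [Prod.fst_sub, Prod.snd_sub]; ring
      rw [c4] at c3
      linarith
    simp only [Pi.sub_apply]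
    linear_combination hz
  have hA := l2_conv_right fdf hg (norm_trigSum_le hg)
  have hB := l2_conv_left fSf fdg (trig_lowP_le hK hψ a b (4 / R) hf)
  have sA : Summable fun n => ‖convCoef (f - Sf) g n‖ ^ 2 :=
    summable_fs (support_conv fdf hg) _ (by intro n h; simp [h])
  have sB : Summable fun n => ‖convCoef Sf (g - Sg) n‖ ^ 2 :=
    summable_fs (support_conv fSf fdg) _ (by intro n h; simp [h])
  have hA2 : ∑' n, ‖(f - Sf) n‖ ^ 2 ≤
      ∑' n : ℤ × ℤ, (if R ≤ 4 * |a * n.1 + b * n.2| then 1 else 0) * ‖f n‖ ^ 2 :=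
    Summable.tsum_le_tsum (hd f) (summable_fs fdf _ (by intro n h; simp [h]))
      (summable_fs hf _ (by intro n h; simp [h]))
  have hB2 : ∑' n, ‖(g - Sg) n‖ ^ 2 ≤
      ∑' n : ℤ × ℤ, (if R ≤ 4 * |a * n.1 + b * n.2| then 1 else 0) * ‖g n‖ ^ 2 :=
    Summable.tsum_le_tsum (hd g) (summable_fs fdg _ (by intro n h; simp [h]))
      (summable_fs hg _ (by intro n h; simp [h]))
  have hC : ∑' n : ℤ × ℤ, (if R ≤ |a * n.1 + b * n.2| then 1 else 0) * ‖convCoef f g n‖ ^ 2 ≤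
      ∑' n, (2 * ‖convCoef (f - Sf) g n‖ ^ 2 + 2 * ‖convCoef Sf (g - Sg) n‖ ^ 2) := by
    refine Summable.tsum_le_tsum (fun n => ?_)
      (summable_fs (support_conv hf hg) _ (by intro n h; simp [h]))
      ((sA.mul_left 2).add (sB.mul_left 2))
    split_ifs with hh
    · rw [hdec n hh, one_mul]
      have := norm_add_le (convCoef (f - Sf) g n) (convCoef Sf (g - Sg) n)
      have := norm_nonneg (convCoef (f - Sf) g n + convCoef Sf (g - Sg) n)
      nlinarith [sq_nonneg (‖convCoef (f - Sf) g n‖ - ‖convCoef Sf (g - Sg) n‖)]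
    · rw [zero_mul]; positivity
  rw [Summable.tsum_add (sA.mul_left 2) (sB.mul_left 2), tsum_mul_left, tsum_mul_left] at hC
  have hA3 := mul_le_mul_of_nonneg_left hA2 (sq_nonneg (supNorm g))
  have hB3 := mul_le_mul_of_nonneg_left hB2 (sq_nonneg ((∫ v, ‖K v‖) * supNorm f))
  linarith

/-- The measure with density `‖h n‖²`. -/
noncomputable def muH (h : ℤ × ℤ → ℂ) : Measure (ℤ × ℤ) :=
  Measure.count.withDensity fun n => ENNReal.ofReal (‖h n‖ ^ 2)

lemma lintegral_muH {h : ℤ × ℤ → ℂ} (hh : (Function.support h).Finite) (u : ℤ × ℤ → ℝ)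
    (hu : ∀ n, 0 ≤ u n) :
    ∫⁻ n, ENNReal.ofReal (u n) ∂muH h = ENNReal.ofReal (∑' n, u n * ‖h n‖ ^ 2) := by
  unfold muH
  rw [lintegral_withDensity_eq_lintegral_mul _ (measurable_of_countable _)
    (measurable_of_countable _), lintegral_count,
    ENNReal.ofReal_tsum_of_nonneg (fun n => mul_nonneg (hu n) (by positivity))
    (summable_fs hh _ (by intro n h; simp [h]))]
  refine tsum_congr fun n => ?_
  rw [Pi.mul_apply, mul_comm, ENNReal.ofReal_mul (hu n)]

lemma muH_apply {h : ℤ × ℤ → ℂ} (hh : (Function.support h).Finite) (P : ℤ × ℤ → Prop)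
    [DecidablePred P] :
    muH h {n | P n} = ENNReal.ofReal (∑' n, (if P n then 1 else 0) * ‖h n‖ ^ 2) := by
  rw [← lintegral_muH hh (fun n => if P n then 1 else 0) (by intro n; positivity),
    ← lintegral_indicator_one (Set.to_countable _).measurableSet]
  refine lintegral_congr fun n => ?_
  by_cases hn : P n <;> simp [hn]

lemma homog_le (a b s : ℝ) (hs : 0 < s) : ∃ L : ℝ, ∀ f g : ℤ × ℤ → ℂ,
    (Function.support f).Finite → (Function.support g).Finite →
    ∑' n : ℤ × ℤ, |a * n.1 + b * n.2| ^ s * ‖convCoef f g n‖ ^ 2 ≤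
      2 * supNorm g ^ 2 * ∑' n : ℤ × ℤ, (4 * |a * n.1 + b * n.2|) ^ s * ‖f n‖ ^ 2 +
      2 * (L * supNorm f) ^ 2 * ∑' n : ℤ × ℤ, (4 * |a * n.1 + b * n.2|) ^ s * ‖g n‖ ^ 2 := by
  obtain ⟨ψ, K, hK, h0, h1, h2, h3, hψ⟩ := exists_cutoff
  refine ⟨∫ v, ‖K v‖, fun f g hf hg => ?_⟩
  set A := 2 * supNorm g ^ 2 with hA
  set B := 2 * ((∫ v, ‖K v‖) * supNorm f) ^ 2 with hB
  have hA0 : 0 ≤ A := by positivity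
  have hB0 : 0 ≤ B := by positivity
  have n1 : ∀ h : ℤ × ℤ → ℂ, 0 ≤
      ∑' n : ℤ × ℤ, (4 * |a * (n.1 : ℝ) + b * n.2|) ^ s * ‖h n‖ ^ 2 :=
    fun h => tsum_nonneg fun n => by positivity
  have n2 : ∀ (h : ℤ × ℤ → ℂ) (t : ℝ), 0 ≤
      ∑' n : ℤ × ℤ, (if t ≤ 4 * |a * (n.1 : ℝ) + b * n.2| then 1 else 0) * ‖h n‖ ^ 2 :=
    fun h t => tsum_nonneg fun n => by positivity
  let ν : Measure (ℤ × ℤ) := ENNReal.ofReal A • muH f + ENNReal.ofReal B • muH g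
  rw [← ENNReal.ofReal_le_ofReal_iff (add_nonneg (mul_nonneg hA0 (n1 f)) (mul_nonneg hB0 (n1 g)))]
  rw [ENNReal.ofReal_add (mul_nonneg hA0 (n1 f)) (mul_nonneg hB0 (n1 g)),
    ENNReal.ofReal_mul hA0, ENNReal.ofReal_mul hB0,
    ← lintegral_muH hf _ (fun n => by positivity), ← lintegral_muH hg _ (fun n => by positivity),
    ← lintegral_muH (support_conv hf hg) _ (fun n => by positivity)]
  have e : ∀ u : ℤ × ℤ → ENNReal, ∫⁻ n, u n ∂ν =
      ENNReal.ofReal A * ∫⁻ n, u n ∂muH f + ENNReal.ofReal B * ∫⁻ n, u n ∂muH g := by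
    intro u
    rw [lintegral_add_measure, lintegral_smul_measure, lintegral_smul_measure]
    rfl
  rw [← e]
  rw [lintegral_rpow_eq_lintegral_meas_le_mul _
      (Filter.Eventually.of_forall fun n => by simp only [Pi.zero_apply]; positivity)
      (measurable_of_countable _).aemeasurable hs,
    lintegral_rpow_eq_lintegral_meas_le_mul _
      (Filter.Eventually.of_forall fun n => by simp only [Pi.zero_apply]; positivity)
      (measurable_of_countable _).aemeasurable hs]
  refine mul_le_mul_right ?_ _
  refine setLIntegral_mono' (measurableSet_Ioi : MeasurableSet (Set.Ioi (0:ℝ))) fun t ht => ?_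
  refine mul_le_mul_left ?_ _
  have ν_eq : ν {n | t ≤ 4 * |a * (n.1 : ℝ) + b * n.2|} = ENNReal.ofReal A *
      muH f {n | t ≤ 4 * |a * (n.1 : ℝ) + b * n.2|} + ENNReal.ofReal B *
      muH g {n | t ≤ 4 * |a * (n.1 : ℝ) + b * n.2|} := rfl
  rw [ν_eq, muH_apply hf, muH_apply hg, muH_apply (support_conv hf hg),
    ← ENNReal.ofReal_mul hA0, ← ENNReal.ofReal_mul hB0,
    ← ENNReal.ofReal_add (mul_nonneg hA0 (n2 f t)) (mul_nonneg hB0 (n2 g t))]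
  exact ENNReal.ofReal_le_ofReal (tail_le hK h0 h1 h2 h3 hψ a b t ht hf hg)

/-- One component of the squared norm. -/
noncomputable def TT (a b s : ℝ) (h : ℤ × ℤ → ℂ) : ℝ :=
  ∑' n : ℤ × ℤ, (1 + (a * (n.1 : ℝ) + b * (n.2 : ℝ)) ^ 2) ^ s * ‖h n‖ ^ 2

lemma TT_nonneg (a b s : ℝ) (h : ℤ × ℤ → ℂ) : 0 ≤ TT a b s h :=
  tsum_nonneg fun n => by positivity

lemma TT_le (a b s : ℝ) (hs : 0 < s) : ∃ A : ℝ, 0 ≤ A ∧ ∀ f g : ℤ × ℤ → ℂ,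
    (Function.support f).Finite → (Function.support g).Finite →
    TT a b s (convCoef f g) ≤ A * (supNorm g ^ 2 * TT a b s f + supNorm f ^ 2 * TT a b s g) := by
  obtain ⟨L, hL⟩ := homog_le a b (2 * s) (by positivity)
  refine ⟨(2:ℝ) ^ s * (1 + 2 * (4:ℝ) ^ (2 * s) * (1 + L ^ 2)), by positivity,
    fun f g hf hg => ?_⟩
  have hfg := support_conv hf hg
  have hw : ∀ x : ℝ, |x| ^ (2 * s) = (x ^ 2) ^ s := by
    intro x
    rw [Real.rpow_mul (abs_nonneg _), Real.rpow_two, sq_abs]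
  have e1 : TT a b s (convCoef f g) ≤ (2:ℝ) ^ s * (∑' n, ‖convCoef f g n‖ ^ 2 +
      ∑' n : ℤ × ℤ, |a * n.1 + b * n.2| ^ (2 * s) * ‖convCoef f g n‖ ^ 2) := by
    have s1 : Summable fun n => ‖convCoef f g n‖ ^ 2 :=
      summable_fs hfg _ (by intro n h; simp [h])
    have s2 : Summable fun n : ℤ × ℤ =>
        |a * (n.1 : ℝ) + b * n.2| ^ (2 * s) * ‖convCoef f g n‖ ^ 2 :=
      summable_fs hfg _ (by intro n h; simp [h])
    rw [← Summable.tsum_add s1 s2, ← tsum_mul_left]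
    refine Summable.tsum_le_tsum (fun n => ?_) (summable_fs hfg _ (by intro n h; simp [h]))
      ((s1.add s2).mul_left _)
    rw [hw]
    set x := a * (n.1 : ℝ) + b * n.2
    have : (1 + x ^ 2) ^ s ≤ 2 ^ s * (1 + (x ^ 2) ^ s) := by
      have hp : 0 ≤ (x ^ 2) ^ s := by positivity
      rcases le_total (x ^ 2) 1 with h | h
      · calc (1 + x ^ 2) ^ s ≤ 2 ^ s := by
              apply Real.rpow_le_rpow (by positivity) (by linarith) hs.le
          _ ≤ 2 ^ s * (1 + (x ^ 2) ^ s) := le_mul_of_one_le_right (by positivity) (by linarith)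
      · calc (1 + x ^ 2) ^ s ≤ (2 * x ^ 2) ^ s := by
              apply Real.rpow_le_rpow (by positivity) (by linarith) hs.le
          _ = 2 ^ s * (x ^ 2) ^ s := Real.mul_rpow (by norm_num) (by positivity)
          _ ≤ 2 ^ s * (1 + (x ^ 2) ^ s) := by gcongr; linarith
    calc _ ≤ 2 ^ s * (1 + (x ^ 2) ^ s) * ‖convCoef f g n‖ ^ 2 := by gcongr
      _ = _ := by ring
  have e2 : ∑' n, ‖convCoef f g n‖ ^ 2 ≤ supNorm g ^ 2 * TT a b s f := by
    refine (l2_conv_right hf hg (norm_trigSum_le hg)).trans ?_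
    gcongr
    refine Summable.tsum_le_tsum (fun n => ?_) (summable_fs hf _ (by intro n h; simp [h]))
      (summable_fs hf _ (by intro n h; simp [h]))
    refine le_mul_of_one_le_left (by positivity) (Real.one_le_rpow ?_ hs.le)
    nlinarith [sq_nonneg (a * (n.1 : ℝ) + b * n.2)]
  have e3 : ∀ h : ℤ × ℤ → ℂ, (Function.support h).Finite →
      ∑' n : ℤ × ℤ, (4 * |a * (n.1 : ℝ) + b * n.2|) ^ (2 * s) * ‖h n‖ ^ 2 ≤
      (4:ℝ) ^ (2 * s) * TT a b s h := by
    intro h hh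
    unfold TT
    rw [← tsum_mul_left]
    refine Summable.tsum_le_tsum (fun n => ?_) (summable_fs hh _ (by intro n h; simp [h]))
      (summable_fs hh _ (by intro n h; simp [h]))
    rw [Real.mul_rpow (by norm_num) (abs_nonneg _), hw, mul_assoc]
    gcongr
    linarith
  have e4 := hL f g hf hg
  have tf := TT_nonneg a b s f
  have tg := TT_nonneg a b s g
  have e5 : ∑' n : ℤ × ℤ, |a * (n.1 : ℝ) + b * n.2| ^ (2 * s) * ‖convCoef f g n‖ ^ 2 ≤
      2 * supNorm g ^ 2 * ((4:ℝ) ^ (2 * s) * TT a b s f) +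
      2 * (L * supNorm f) ^ 2 * ((4:ℝ) ^ (2 * s) * TT a b s g) := by
    refine e4.trans ?_
    gcongr
    · exact e3 f hf
    · exact e3 g hg
  refine e1.trans ?_
  rw [mul_assoc]
  gcongr
  have q : (0:ℝ) ≤ 4 ^ (2 * s) := by positivity
  have u1 : 0 ≤ supNorm g ^ 2 * TT a b s f := by positivity
  have u2 : 0 ≤ supNorm f ^ 2 * TT a b s g := by positivity
  have u3 : 0 ≤ 4 ^ (2 * s) * L ^ 2 * (supNorm g ^ 2 * TT a b s f) := by positivity
  have u4 : 0 ≤ 4 ^ (2 * s) * (supNorm f ^ 2 * TT a b s g) := by positivity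
  nlinarith

lemma sqrt_TT_le (a b s : ℝ) (hs : 0 < s) : ∃ A : ℝ, 0 ≤ A ∧ ∀ f g : ℤ × ℤ → ℂ,
    (Function.support f).Finite → (Function.support g).Finite →
    √(TT a b s (convCoef f g)) ≤ A * (√(TT a b s f) * supNorm g + supNorm f * √(TT a b s g)) := by
  obtain ⟨A, hA, h⟩ := TT_le a b s hs
  refine ⟨√A, Real.sqrt_nonneg _, fun f g hf hg => ?_⟩
  have sf := supNorm_nonneg f
  have sg := supNorm_nonneg g
  refine Real.sqrt_le_iff.2 ⟨by positivity, (h f g hf hg).trans ?_⟩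
  rw [mul_pow, Real.sq_sqrt hA]
  gcongr
  have h1 := Real.sq_sqrt (TT_nonneg a b s f)
  have h2 := Real.sq_sqrt (TT_nonneg a b s g)
  have h3 : 0 ≤ (√(TT a b s f) * supNorm g) * (supNorm f * √(TT a b s g)) := by positivity
  calc _ = supNorm g ^ 2 * √(TT a b s f) ^ 2 + supNorm f ^ 2 * √(TT a b s g) ^ 2 := by
        rw [h1, h2]
    _ ≤ _ := by nlinarith

lemma anisoNorm_eq (ω : ℝ × ℝ) (s₁ s₂ : ℝ) (c : ℤ × ℤ → ℂ) :
    anisoNorm ω s₁ s₂ c = √(TT ω.1 ω.2 s₁ c) + √(TT ω.2 (-ω.1) s₂ c) := by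
  unfold anisoNorm TT
  simp_rw [Real.sqrt_eq_rpow, neg_mul, ← sub_eq_add_neg]

lemma summable_int_weight (p : ℝ) (hp : 1 / 2 < p) :
    Summable fun k : ℤ => (1 + (k : ℝ) ^ 2) ^ (-p) := by
  have h := Real.summable_abs_int_rpow (b := 2 * p) (by linarith)
  refine Summable.of_norm_bounded_eventually (g := fun k : ℤ => |(k : ℝ)| ^ (-(2 * p))) h ?_
  refine (Set.finite_singleton (0 : ℤ)).subset ?_
  intro k hk
  by_contra hk0
  apply hk
  have hk1 : (k : ℝ) ≠ 0 := by simpa using hk0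
  change ‖(1 + (k : ℝ) ^ 2) ^ (-p)‖ ≤ |(k : ℝ)| ^ (-(2 * p))
  rw [Real.norm_of_nonneg (by positivity), show -(2 * p) = 2 * (-p) by ring,
    Real.rpow_mul (abs_nonneg _), Real.rpow_two, sq_abs]
  exact Real.rpow_le_rpow_of_nonpos (by positivity) (by linarith) (by linarith)

lemma summable_lattice (ω : ℝ × ℝ) (hω : ω ≠ 0) (p q : ℝ) (hp : 1 / 2 < p) (hq : 1 / 2 < q) :
    Summable fun n : ℤ × ℤ => (1 + (ω.1 * (n.1 : ℝ) + ω.2 * (n.2 : ℝ)) ^ 2) ^ (-p) *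
      (1 + (ω.2 * (n.1 : ℝ) + -ω.1 * (n.2 : ℝ)) ^ 2) ^ (-q) := by
  have hpos : 0 < ω.1 ^ 2 + ω.2 ^ 2 := by
    by_contra hc
    apply hω
    have h1 : ω.1 ^ 2 = 0 := by nlinarith [sq_nonneg ω.1, sq_nonneg ω.2]
    have h2 : ω.2 ^ 2 = 0 := by nlinarith [sq_nonneg ω.1, sq_nonneg ω.2]
    ext
    · simpa using h1
    · simpa using h2
  set W := ω.1 ^ 2 + ω.2 ^ 2 with hW
  set lam := 2 / √W with hlam
  have hlam0 : 0 < lam := by positivity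
  have hlam2 : lam ^ 2 * W = 4 := by
    rw [hlam, div_pow, Real.sq_sqrt hpos.le]
    field_simp
    norm_num
  let X : ℤ × ℤ → ℝ := fun n => ω.1 * (n.1 : ℝ) + ω.2 * (n.2 : ℝ)
  let Y : ℤ × ℤ → ℝ := fun n => ω.2 * (n.1 : ℝ) + -ω.1 * (n.2 : ℝ)
  let Φ : ℤ × ℤ → ℤ × ℤ := fun n => (⌊lam * X n⌋, ⌊lam * Y n⌋)
  have hΦ : Function.Injective Φ := by
    intro m n hmn
    have h1 : ⌊lam * X m⌋ = ⌊lam * X n⌋ := congrArg Prod.fst hmn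
    have h2 : ⌊lam * Y m⌋ = ⌊lam * Y n⌋ := congrArg Prod.snd hmn
    have h1' := Int.abs_sub_lt_one_of_floor_eq_floor h1
    have h2' := Int.abs_sub_lt_one_of_floor_eq_floor h2
    have k1 : (lam * X m - lam * X n) ^ 2 < 1 := by
      rw [← sq_abs]; nlinarith [abs_nonneg (lam * X m - lam * X n)]
    have k2 : (lam * Y m - lam * Y n) ^ 2 < 1 := by
      rw [← sq_abs]; nlinarith [abs_nonneg (lam * Y m - lam * Y n)]
    have k3 : (lam * X m - lam * X n) ^ 2 + (lam * Y m - lam * Y n) ^ 2 =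
        4 * (((m.1 : ℝ) - n.1) ^ 2 + ((m.2 : ℝ) - n.2) ^ 2) := by
      rw [← hlam2, hW]
      simp only [X, Y]
      ring
    have k4 : (((m.1 - n.1) ^ 2 + (m.2 - n.2) ^ 2 : ℤ) : ℝ) < 1 := by
      push_cast; linarith
    have k5 : (m.1 - n.1) ^ 2 + (m.2 - n.2) ^ 2 < 1 := by exact_mod_cast k4
    have k6 : (m.1 - n.1) ^ 2 = 0 := by nlinarith [sq_nonneg (m.1 - n.1), sq_nonneg (m.2 - n.2)]
    have k7 : (m.2 - n.2) ^ 2 = 0 := by nlinarith [sq_nonneg (m.1 - n.1), sq_nonneg (m.2 - n.2)]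
    ext
    · have := pow_eq_zero_iff (two_ne_zero) |>.1 k6; omega
    · have := pow_eq_zero_iff (two_ne_zero) |>.1 k7; omega
  have hS := ((summable_int_weight p hp).mul_of_nonneg (summable_int_weight q hq)
    (fun k => by simp only [Pi.zero_apply]; positivity)
    (fun k => by simp only [Pi.zero_apply]; positivity)).comp_injective hΦ
  set M := 3 + 2 * lam ^ 2 with hM
  have hM0 : 0 < M := by positivity
  have hcmp : ∀ (x r : ℝ), 0 < r →
      (1 + x ^ 2) ^ (-r) ≤ M ^ r * (1 + (⌊lam * x⌋ : ℝ) ^ 2) ^ (-r) := by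
    intro x r hr
    have f1 : (⌊lam * x⌋ : ℝ) ^ 2 ≤ 2 * lam ^ 2 * x ^ 2 + 2 := by
      have a1 := Int.floor_le (lam * x)
      have a2 := Int.lt_floor_add_one (lam * x)
      have a3 : (lam * x - ⌊lam * x⌋) ^ 2 ≤ 1 := by nlinarith
      nlinarith [sq_nonneg (2 * (lam * x) - ⌊lam * x⌋)]
    have f2 : 1 + (⌊lam * x⌋ : ℝ) ^ 2 ≤ M * (1 + x ^ 2) := by
      rw [hM]; nlinarith [sq_nonneg x, sq_nonneg lam]
    have f3 : (M * (1 + x ^ 2)) ^ (-r) ≤ (1 + (⌊lam * x⌋ : ℝ) ^ 2) ^ (-r) :=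
      Real.rpow_le_rpow_of_nonpos (by positivity) f2 (by linarith)
    calc (1 + x ^ 2) ^ (-r) = M ^ r * (M * (1 + x ^ 2)) ^ (-r) := by
          rw [Real.mul_rpow hM0.le (by positivity), ← mul_assoc, ← Real.rpow_add hM0]
          simp
      _ ≤ _ := by gcongr
  refine Summable.of_nonneg_of_le (fun n => by positivity) (fun n => ?_)
    (hS.mul_left (M ^ p * M ^ q))
  have g1 := hcmp (X n) p (by linarith)
  have g2 := hcmp (Y n) q (by linarith)
  calc _ ≤ (M ^ p * (1 + (⌊lam * X n⌋ : ℝ) ^ 2) ^ (-p)) *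
        (M ^ q * (1 + (⌊lam * Y n⌋ : ℝ) ^ 2) ^ (-q)) := by
        exact mul_le_mul g1 g2 (by positivity) (by positivity)
    _ = _ := by simp only [Function.comp, Φ]; ring

lemma summable_inv_weight (ω : ℝ × ℝ) (hω : ω ≠ 0) (s₁ s₂ : ℝ)
    (hs₁ : 1 / 2 < s₁) (hs₂ : 1 / 2 < s₂) (hsum : 1 / s₁ + 1 / s₂ < 2) :
    Summable fun n : ℤ × ℤ => ((1 + (ω.1 * (n.1 : ℝ) + ω.2 * (n.2 : ℝ)) ^ 2) ^ s₁ +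
      (1 + (ω.2 * (n.1 : ℝ) + -ω.1 * (n.2 : ℝ)) ^ 2) ^ s₂)⁻¹ := by
  have p1 : 0 < s₁ := by linarith
  have p2 : 0 < s₂ := by linarith
  set t := 1 - (1 / s₁ + 1 / s₂) / 2 with ht
  have ht0 : 0 < t := by linarith
  set θ := 1 / (2 * s₁) + t / 2 with hθ
  have hθ' : 1 - θ = 1 / (2 * s₂) + t / 2 := by rw [hθ, ht]; field_simp; ring
  have hθ0 : 0 < θ := by positivity
  have hθ1 : 0 < 1 - θ := by rw [hθ']; positivity
  have q1 : 1 / 2 < s₁ * θ := by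
    have : s₁ * θ = 1 / 2 + s₁ * t / 2 := by rw [hθ]; field_simp
    have : 0 < s₁ * t := by positivity
    linarith
  have q2 : 1 / 2 < s₂ * (1 - θ) := by
    have : s₂ * (1 - θ) = 1 / 2 + s₂ * t / 2 := by rw [hθ']; field_simp
    have : 0 < s₂ * t := by positivity
    linarith
  refine Summable.of_nonneg_of_le (fun n => by positivity) (fun n => ?_)
    (summable_lattice ω hω _ _ q1 q2)
  set x := 1 + (ω.1 * (n.1 : ℝ) + ω.2 * (n.2 : ℝ)) ^ 2
  set y := 1 + (ω.2 * (n.1 : ℝ) + -ω.1 * (n.2 : ℝ)) ^ 2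
  have hx : 0 < x := by positivity
  have hy : 0 < y := by positivity
  rw [Real.rpow_neg hx.le, Real.rpow_neg hy.le, ← mul_inv]
  apply inv_anti₀ (by positivity)
  rw [Real.rpow_mul hx.le, Real.rpow_mul hy.le]
  have hX : 0 < x ^ s₁ := by positivity
  have hY : 0 < y ^ s₂ := by positivity
  refine (Real.geom_mean_le_arith_mean2_weighted hθ0.le hθ1.le hX.le hY.le (by ring)).trans ?_
  nlinarith [mul_pos hθ1 hX, mul_pos hθ0 hY]

lemma supNorm_le (ω : ℝ × ℝ) (hω : ω ≠ 0) (s₁ s₂ : ℝ)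
    (hs₁ : 1 / 2 < s₁) (hs₂ : 1 / 2 < s₂) (hsum : 1 / s₁ + 1 / s₂ < 2) :
    ∃ D : ℝ, 0 ≤ D ∧ ∀ g : ℤ × ℤ → ℂ, (Function.support g).Finite →
      supNorm g ≤ D * anisoNorm ω s₁ s₂ g := by
  have hS := summable_inv_weight ω hω s₁ s₂ hs₁ hs₂ hsum
  set w : ℤ × ℤ → ℝ := fun n => (1 + (ω.1 * (n.1 : ℝ) + ω.2 * (n.2 : ℝ)) ^ 2) ^ s₁ +
      (1 + (ω.2 * (n.1 : ℝ) + -ω.1 * (n.2 : ℝ)) ^ 2) ^ s₂ with hw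
  have hwpos : ∀ n, 0 < w n := fun n => by simp only [hw]; positivity
  refine ⟨√(∑' n, (w n)⁻¹), Real.sqrt_nonneg _, fun g hg => ?_⟩
  rw [anisoNorm_eq]
  set T1 := TT ω.1 ω.2 s₁ g with hT1
  set T2 := TT ω.2 (-ω.1) s₂ g with hT2
  have hT1' : 0 ≤ T1 := TT_nonneg _ _ _ _
  have hT2' : 0 ≤ T2 := TT_nonneg _ _ _ _
  have hS0 : 0 ≤ ∑' n, (w n)⁻¹ := tsum_nonneg fun n => (inv_pos.2 (hwpos n)).le
  have hsup : supNorm g ≤ ∑' n, ‖g n‖ := ciSup_le fun x => norm_trigSum_le_tsum hg x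
  refine hsup.trans ?_
  have h1 : ∑' n, ‖g n‖ = ∑ n ∈ hg.toFinset, ‖g n‖ := by
    apply tsum_eq_sum
    intro n hn
    simp at hn
    simp [hn]
  have h2 : T1 + T2 = ∑ n ∈ hg.toFinset, w n * ‖g n‖ ^ 2 := by
    rw [hT1, hT2]
    unfold TT
    rw [← Summable.tsum_add (summable_fs hg _ (by intro n h; simp [h]))
      (summable_fs hg _ (by intro n h; simp [h]))]
    rw [tsum_eq_sum (s := hg.toFinset)]
    · refine Finset.sum_congr rfl fun n _ => ?_
      simp only [hw]; ring
    · intro n hn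
      simp at hn
      simp [hn]
  have h3 : (∑ n ∈ hg.toFinset, ‖g n‖) ^ 2 ≤
      (∑ n ∈ hg.toFinset, (w n)⁻¹) * ∑ n ∈ hg.toFinset, w n * ‖g n‖ ^ 2 := by
    apply Finset.sum_sq_le_sum_mul_sum_of_sq_eq_mul
    · intro n _; exact (inv_pos.2 (hwpos n)).le
    · intro n _; have := hwpos n; positivity
    · intro n _; have := (hwpos n).ne'; field_simp
  have h4 : ∑ n ∈ hg.toFinset, (w n)⁻¹ ≤ ∑' n, (w n)⁻¹ :=
    hS.sum_le_tsum _ fun n _ => (inv_pos.2 (hwpos n)).le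
  rw [h1]
  refine abs_le_of_sq_le_sq' ?_ (by positivity) |>.2
  rw [mul_pow, Real.sq_sqrt hS0]
  calc _ ≤ (∑' n, (w n)⁻¹) * (T1 + T2) := by
        rw [h2]
        refine h3.trans ?_
        gcongr
    _ ≤ _ := by
        gcongr
        have := Real.sq_sqrt hT1'
        have := Real.sq_sqrt hT2'
        nlinarith [mul_nonneg (Real.sqrt_nonneg T1) (Real.sqrt_nonneg T2)]

/-- the algebra property of `H^{s₁,s₂}_ω`:
`N(f·g) ≤ C·(N(f)‖g‖_∞ + ‖f‖_∞ N(g)) ≤ C'·N(f)·N(g)` for trigonometric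
polynomials, where `N` is the anisotropic Sobolev norm. -/
theorem stmt_5 (ω : ℝ × ℝ) (hω : ω ≠ 0) (s₁ s₂ : ℝ)
    (hs₁ : 1 / 2 < s₁) (hs₂ : 1 / 2 < s₂) (hsum : 1 / s₁ + 1 / s₂ < 2) :
    ∃ C C' : ℝ, ∀ f g : ℤ × ℤ → ℂ,
      (Function.support f).Finite → (Function.support g).Finite →
      anisoNorm ω s₁ s₂ (convCoef f g) ≤
          C * (anisoNorm ω s₁ s₂ f * supNorm g + supNorm f * anisoNorm ω s₁ s₂ g) ∧
        C * (anisoNorm ω s₁ s₂ f * supNorm g + supNorm f * anisoNorm ω s₁ s₂ g) ≤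
          C' * anisoNorm ω s₁ s₂ f * anisoNorm ω s₁ s₂ g := by
  obtain ⟨A, hA, h1⟩ := sqrt_TT_le ω.1 ω.2 s₁ (by linarith)
  obtain ⟨B, hB, h2⟩ := sqrt_TT_le ω.2 (-ω.1) s₂ (by linarith)
  obtain ⟨D, hD, h3⟩ := supNorm_le ω hω s₁ s₂ hs₁ hs₂ hsum
  refine ⟨A + B, (A + B) * (2 * D), fun f g hf hg => ?_⟩
  have sf := supNorm_nonneg f
  have sg := supNorm_nonneg g
  have nn : ∀ c, 0 ≤ anisoNorm ω s₁ s₂ c := fun c => by rw [anisoNorm_eq]; positivity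
  constructor
  · have e1 := h1 f g hf hg
    have e2 := h2 f g hf hg
    simp only [anisoNorm_eq]
    set a1 := √(TT ω.1 ω.2 s₁ f)
    set a2 := √(TT ω.2 (-ω.1) s₂ f)
    set b1 := √(TT ω.1 ω.2 s₁ g)
    set b2 := √(TT ω.2 (-ω.1) s₂ g)
    have z1 : 0 ≤ A * (a2 * supNorm g + supNorm f * b2) := by positivity
    have z2 : 0 ≤ B * (a1 * supNorm g + supNorm f * b1) := by positivity
    linarith
  · have e1 := h3 f hf
    have e2 := h3 g hg
    have k1 := mul_le_mul_of_nonneg_left e2 (nn f)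
    have k2 := mul_le_mul_of_nonneg_right e1 (nn g)
    have : anisoNorm ω s₁ s₂ f * supNorm g + supNorm f * anisoNorm ω s₁ s₂ g ≤
        2 * D * anisoNorm ω s₁ s₂ f * anisoNorm ω s₁ s₂ g := by linarith
    calc _ ≤ (A + B) * (2 * D * anisoNorm ω s₁ s₂ f * anisoNorm ω s₁ s₂ g) :=
          mul_le_mul_of_nonneg_left this (by positivity)
      _ = _ := by ring
end

section
/- Let m : ℝ² × ℝ² → ℂ be measurable, continuous at every point of ℤ² × ℤ², and satisfy |m(ξ₁, ξ₂)| ≤ C₀·exp(‖(ξ₁, ξ₂)‖) for some C₀ > 0 and all ξ₁, ξ₂ ∈ ℝ². Let P, Q, R be trigonometric polynomials on 𝕋² with coefficients P̂, Q̂, R̂, let α, β, γ > 0 satisfy α + β + γ = 1, and for δ > 0 set w_δ(y) = e^{−πδ‖y‖²} on ℝ². For ε > 0 define Φ_ε : ℝ² → ℂ by Φ_ε(x) = ∫_{ℝ²}∫_{ℝ²} m(ξ₁, ξ₂)·[Σ_{j∈ℤ²} P̂(j)(αε)^{−1}e^{−π‖ξ₁−j‖²/(αε)}]·[Σ_{k∈ℤ²}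 Q̂(k)(βε)^{−1}e^{−π‖ξ₂−k‖²/(βε)}]·e^{2πi(ξ₁+ξ₂)·x} dξ₁ dξ₂. Then lim_{ε→0⁺} ε·∫_{ℝ²} Φ_ε(x)·conj(R(x))·w_{γε}(x) dx = ∫_{[0,1]²} [Σ_{j,k∈ℤ²} m(j,k)·P̂(j)·Q̂(k)·e^{2πi(j+k)·x}]·conj(R(x)) dx. -/
open scoped Real
open MeasureTheory Filter

/-- The Fourier transform of `P·w_δ` (a sum of shifted Gaussians):
`ξ ↦ Σ_{j∈ℤ²} P̂(j) δ^{−1} e^{−π‖ξ−j‖²/δ}`. -/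
noncomputable def gaussApprox (c : ℤ × ℤ → ℂ) (δ : ℝ) (ξ : ℝ × ℝ) : ℂ :=
  ∑' j : ℤ × ℤ, c j *
    ((δ⁻¹ * Real.exp (-(Real.pi * ((ξ.1 - (j.1 : ℝ)) ^ 2 + (ξ.2 - (j.2 : ℝ)) ^ 2)) / δ) : ℝ) : ℂ)

noncomputable def EE (t : ℝ) : ℂ := Complex.exp (2 * Real.pi * Complex.I * (t : ℂ))

noncomputable def GG (δ : ℝ) (J ξ : ℝ × ℝ) : ℝ :=
  δ⁻¹ * Real.exp (-(Real.pi * ((ξ.1 - J.1) ^ 2 + (ξ.2 - J.2) ^ 2)) / δ)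

noncomputable def WW (δ : ℝ) (x : ℝ × ℝ) : ℝ :=
  Real.exp (-(Real.pi * δ * (x.1 ^ 2 + x.2 ^ 2)))

noncomputable def hh (a c t : ℝ) : ℝ := Real.exp |t| * Real.exp (-(Real.pi * (t - c) ^ 2) / a)

noncomputable def l1 (ξ : (ℝ × ℝ) × (ℝ × ℝ)) : ℝ := |ξ.1.1| + |ξ.1.2| + (|ξ.2.1| + |ξ.2.2|)

lemma EE_norm (t : ℝ) : ‖EE t‖ = 1 := by
  unfold EE
  rw [Complex.norm_exp]
  simp

lemma EE_add (s t : ℝ) : EE (s + t) = EE s * EE t := by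
  unfold EE
  rw [← Complex.exp_add]; push_cast; ring_nf

lemma EE_conj (t : ℝ) : (starRingEnd ℂ) (EE t) = EE (-t) := by
  unfold EE
  rw [← Complex.exp_conj]; simp [map_ofNat]

lemma EE_cont : Continuous EE := by unfold EE; fun_prop

lemma GG_nonneg {δ : ℝ} (hδ : 0 < δ) (J ξ : ℝ × ℝ) : 0 ≤ GG δ J ξ := by
  unfold GG; positivity

lemma GG_le {δ : ℝ} (hδ : 0 < δ) (J ξ : ℝ × ℝ) : GG δ J ξ ≤ δ⁻¹ := by
  unfold GG
  have : Real.exp (-(Real.pi * ((ξ.1 - J.1) ^ 2 + (ξ.2 - J.2) ^ 2)) / δ) ≤ 1 := by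
    rw [Real.exp_le_one_iff, neg_div]
    have : 0 ≤ (Real.pi * ((ξ.1 - J.1) ^ 2 + (ξ.2 - J.2) ^ 2)) / δ := by positivity
    linarith
  have h2 : 0 < δ⁻¹ := by positivity
  nlinarith

lemma GG_cont (δ : ℝ) (J : ℝ × ℝ) : Continuous (GG δ J) := by unfold GG; fun_prop

lemma WW_cont (δ : ℝ) : Continuous (WW δ) := by unfold WW; fun_prop

lemma int_gauss1 {b : ℝ} (hb : 0 < b) (c d : ℝ) :
    Integrable (fun t : ℝ => Real.exp (-b * t ^ 2 + c * t + d)) := by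
  have h := (integrable_cexp_quadratic (b := (b : ℂ)) (by simpa using hb) c d).norm
  refine h.congr (Eventually.of_forall fun t => ?_)
  simp only [Complex.norm_exp]
  congr 1
  have : (-(b : ℂ) * (t : ℂ) ^ 2 + c * t + d) = ((-b * t ^ 2 + c * t + d : ℝ) : ℂ) := by
    push_cast; ring
  rw [this, Complex.ofReal_re]

lemma hh_int {a : ℝ} (ha : 0 < a) (c : ℝ) : Integrable (hh a c) := by
  have hb : 0 < Real.pi / a := by positivity
  have h1 := int_gauss1 hb (2 * Real.pi * c / a + 1) (-Real.pi * c ^ 2 / a)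
  have h2 := int_gauss1 hb (2 * Real.pi * c / a - 1) (-Real.pi * c ^ 2 / a)
  refine (h1.add h2).mono' ?_ (Eventually.of_forall fun t => ?_)
  · exact (by unfold hh; fun_prop : Continuous (hh a c)).aestronglyMeasurable
  · have e1 : Real.exp (-(Real.pi / a) * t ^ 2 + (2 * Real.pi * c / a + 1) * t + -Real.pi * c ^ 2 / a)
      = Real.exp t * Real.exp (-(Real.pi * (t - c) ^ 2) / a) := by
      rw [← Real.exp_add]; congr 1; field_simp; ring
    have e2 : Real.exp (-(Real.pi / a) * t ^ 2 + (2 * Real.pi * c / a - 1) * t + -Real.pi * c ^ 2 / a)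
      = Real.exp (-t) * Real.exp (-(Real.pi * (t - c) ^ 2) / a) := by
      rw [← Real.exp_add]; congr 1; field_simp; ring
    simp only [Pi.add_apply, e1, e2, ← add_mul]
    unfold hh
    rw [Real.norm_of_nonneg (by positivity)]
    gcongr
    rcases abs_cases t with ⟨h, _⟩ | ⟨h, _⟩ <;> rw [h] <;> linarith [Real.exp_pos t, Real.exp_pos (-t)]

lemma GG_split (a : ℝ) (J ξ : ℝ × ℝ) : Real.exp (|ξ.1| + |ξ.2|) * GG a J ξ
    = a⁻¹ * (hh a J.1 ξ.1 * hh a J.2 ξ.2) := by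
  unfold GG hh
  rw [Real.exp_add]
  have : Real.exp (-(Real.pi * ((ξ.1 - J.1) ^ 2 + (ξ.2 - J.2) ^ 2)) / a) =
    Real.exp (-(Real.pi * (ξ.1 - J.1) ^ 2) / a) * Real.exp (-(Real.pi * (ξ.2 - J.2) ^ 2) / a) := by
    rw [← Real.exp_add]; congr 1; ring
  rw [this]; ring

lemma dom_int {a b : ℝ} (ha : 0 < a) (hb : 0 < b) (J K : ℝ × ℝ) :
    Integrable (fun ξ : (ℝ × ℝ) × (ℝ × ℝ) => Real.exp (l1 ξ) * GG a J ξ.1 * GG b K ξ.2) := by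
  have h := ((((hh_int ha J.1).mul_prod (hh_int ha J.2)).const_mul a⁻¹).mul_prod
    (((hh_int hb K.1).mul_prod (hh_int hb K.2)).const_mul b⁻¹))
  refine h.congr (Eventually.of_forall fun ξ => ?_)
  simp only []
  rw [← GG_split, ← GG_split]
  unfold l1
  rw [Real.exp_add (|ξ.1.1| + |ξ.1.2|)]; ring

lemma mGG_int (m : (ℝ × ℝ) × (ℝ × ℝ) → ℂ) (hm : Measurable m) (C : ℝ)
    (hg : ∀ ξ, ‖m ξ‖ ≤ C * Real.exp (l1 ξ)) {a b : ℝ} (ha : 0 < a) (hb : 0 < b) (J K : ℝ × ℝ) :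
    Integrable (fun ξ : (ℝ × ℝ) × (ℝ × ℝ) => m ξ * (GG a J ξ.1 : ℂ) * (GG b K ξ.2 : ℂ)) := by
  refine ((dom_int ha hb J K).const_mul C).mono' ?_ (Eventually.of_forall fun ξ => ?_)
  · have := (GG_cont a J).measurable
    have := (GG_cont b K).measurable
    exact Measurable.aestronglyMeasurable (by fun_prop)
  · rw [norm_mul, norm_mul, Complex.norm_real, Complex.norm_real,
      Real.norm_of_nonneg (GG_nonneg ha _ _), Real.norm_of_nonneg (GG_nonneg hb _ _)]
    have := GG_nonneg ha J ξ.1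
    have := GG_nonneg hb K ξ.2
    calc _ ≤ (C * Real.exp (l1 ξ)) * GG a J ξ.1 * GG b K ξ.2 := by gcongr; exact hg ξ
      _ = _ := by ring

lemma WW_int {δ : ℝ} (hδ : 0 < δ) : Integrable (WW δ) := by
  have h := int_gauss1 (b := Real.pi * δ) (by positivity) 0 0
  refine (h.mul_prod h).congr (Eventually.of_forall fun x => ?_)
  unfold WW
  simp only [← Real.exp_add]
  congr 1; ring

lemma four1 {δ : ℝ} (hδ : 0 < δ) (η : ℝ) :
    ∫ x : ℝ, EE (η * x) * (Real.exp (-(Real.pi * δ * x ^ 2)) : ℂ) =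
      ((δ⁻¹ : ℝ) : ℂ) ^ (1 / 2 : ℂ) * (Real.exp (-(Real.pi * η ^ 2) / δ) : ℂ) := by
  have h := fourierIntegral_gaussian (b := ((Real.pi * δ : ℝ) : ℂ))
    (by rw [Complex.ofReal_re]; positivity) ((2 * Real.pi * η : ℝ) : ℂ)
  convert h using 2
  · funext x
    unfold EE
    push_cast
    congr 2 <;> ring
  · congr 1
    push_cast
    have : (Real.pi : ℂ) ≠ 0 := by exact_mod_cast Real.pi_ne_zero
    field_simp
  · push_cast
    congr 1
    have : (Real.pi : ℂ) ≠ 0 := by exact_mod_cast Real.pi_ne_zero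
    have : (δ : ℂ) ≠ 0 := by exact_mod_cast hδ.ne'
    field_simp
    ring

lemma four2 {δ : ℝ} (hδ : 0 < δ) (η N : ℝ × ℝ) :
    ∫ x : ℝ × ℝ, EE (η.1 * x.1 + η.2 * x.2) * (starRingEnd ℂ) (EE (N.1 * x.1 + N.2 * x.2)) *
      (WW δ x : ℂ) = (GG δ N η : ℂ) := by
  have h := integral_prod_mul (μ := (volume : Measure ℝ)) (ν := (volume : Measure ℝ))
    (fun x : ℝ => EE ((η.1 - N.1) * x) * (Real.exp (-(Real.pi * δ * x ^ 2)) : ℂ))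
    (fun x : ℝ => EE ((η.2 - N.2) * x) * (Real.exp (-(Real.pi * δ * x ^ 2)) : ℂ))
  rw [four1 hδ, four1 hδ] at h
  have hc : ((δ⁻¹ : ℝ) : ℂ) ^ (1 / 2 : ℂ) * ((δ⁻¹ : ℝ) : ℂ) ^ (1 / 2 : ℂ) = ((δ⁻¹ : ℝ) : ℂ) := by
    rw [← Complex.cpow_add]
    · norm_num
    · exact_mod_cast (by positivity : δ⁻¹ ≠ 0)
  calc _ = _ := ?_
    _ = _ := h
    _ = _ := ?_
  · rw [Measure.volume_eq_prod]
    congr 1; funext x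
    rw [EE_conj, ← EE_add]
    have : η.1 * x.1 + η.2 * x.2 + -(N.1 * x.1 + N.2 * x.2) =
      (η.1 - N.1) * x.1 + (η.2 - N.2) * x.2 := by ring
    rw [this, EE_add]
    have : WW δ x = Real.exp (-(Real.pi * δ * x.1 ^ 2)) * Real.exp (-(Real.pi * δ * x.2 ^ 2)) := by
      unfold WW; rw [← Real.exp_add]; congr 1; ring
    rw [this]; push_cast; ring
  · have : GG δ N η = δ⁻¹ * (Real.exp (-(Real.pi * (η.1 - N.1) ^ 2) / δ) *
        Real.exp (-(Real.pi * (η.2 - N.2) ^ 2) / δ)) := by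
      unfold GG; rw [← Real.exp_add]; congr 2; ring
    rw [mul_mul_mul_comm, hc, this]; push_cast; ring

lemma joint_int (m : (ℝ × ℝ) × (ℝ × ℝ) → ℂ) (hm : Measurable m) (C : ℝ)
    (hg : ∀ ξ, ‖m ξ‖ ≤ C * Real.exp (l1 ξ)) {a b δ : ℝ} (ha : 0 < a) (hb : 0 < b) (hδ : 0 < δ)
    (J K N : ℝ × ℝ) :
    Integrable (fun p : (ℝ × ℝ) × ((ℝ × ℝ) × (ℝ × ℝ)) =>
      m p.2 * (GG a J p.2.1 : ℂ) * (GG b K p.2.2 : ℂ) *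
        EE ((p.2.1.1 + p.2.2.1) * p.1.1 + (p.2.1.2 + p.2.2.2) * p.1.2) *
        (starRingEnd ℂ) (EE (N.1 * p.1.1 + N.2 * p.1.2)) * (WW δ p.1 : ℂ))
      ((volume : Measure (ℝ × ℝ)).prod (volume : Measure ((ℝ × ℝ) × (ℝ × ℝ)))) := by
  have h := ((WW_int hδ).ofReal (𝕜 := ℂ)).mul_prod (mGG_int m hm C hg ha hb J K)
  refine h.mono ?_ (Eventually.of_forall fun p => ?_)
  · have h1 := (GG_cont a J).measurable
    have h2 := (GG_cont b K).measurable
    have h3 := (WW_cont δ).measurable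
    have h4 := EE_cont.measurable
    simp only [EE_conj]
    exact Measurable.aestronglyMeasurable (by fun_prop)
  · simp only [norm_mul, EE_norm, RCLike.norm_conj, mul_one]
    exact le_of_eq (by simp; ring)

noncomputable def FF (m : (ℝ × ℝ) × (ℝ × ℝ) → ℂ) (a b δ : ℝ) (J K N x : ℝ × ℝ) : ℂ :=
  (∫ ξ : (ℝ × ℝ) × (ℝ × ℝ), m ξ * (GG a J ξ.1 : ℂ) * (GG b K ξ.2 : ℂ) *
    EE ((ξ.1.1 + ξ.2.1) * x.1 + (ξ.1.2 + ξ.2.2) * x.2)) *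
    (starRingEnd ℂ) (EE (N.1 * x.1 + N.2 * x.2)) * (WW δ x : ℂ)

lemma FF_int (m : (ℝ × ℝ) × (ℝ × ℝ) → ℂ) (hm : Measurable m) (C : ℝ)
    (hg : ∀ ξ, ‖m ξ‖ ≤ C * Real.exp (l1 ξ)) {a b δ : ℝ} (ha : 0 < a) (hb : 0 < b) (hδ : 0 < δ)
    (J K N : ℝ × ℝ) : Integrable (FF m a b δ J K N) := by
  have h := (joint_int m hm C hg ha hb hδ J K N).integral_prod_left
  refine h.congr (Eventually.of_forall fun x => ?_)
  simp only [FF, integral_mul_const]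

lemma FF_integral (m : (ℝ × ℝ) × (ℝ × ℝ) → ℂ) (hm : Measurable m) (C : ℝ)
    (hg : ∀ ξ, ‖m ξ‖ ≤ C * Real.exp (l1 ξ)) {a b δ : ℝ} (ha : 0 < a) (hb : 0 < b) (hδ : 0 < δ)
    (J K N : ℝ × ℝ) : ∫ x, FF m a b δ J K N x =
      ∫ ξ : (ℝ × ℝ) × (ℝ × ℝ), m ξ * (GG a J ξ.1 : ℂ) * (GG b K ξ.2 : ℂ) *
        (GG δ N (ξ.1 + ξ.2) : ℂ) := by
  have h := joint_int m hm C hg ha hb hδ J K N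
  have h2 := integral_integral_swap (f := fun (x : ℝ × ℝ) (ξ : (ℝ × ℝ) × (ℝ × ℝ)) =>
      m ξ * (GG a J ξ.1 : ℂ) * (GG b K ξ.2 : ℂ) *
        EE ((ξ.1.1 + ξ.2.1) * x.1 + (ξ.1.2 + ξ.2.2) * x.2) *
        (starRingEnd ℂ) (EE (N.1 * x.1 + N.2 * x.2)) * (WW δ x : ℂ)) h
  calc _ = _ := ?_
    _ = _ := h2
    _ = _ := ?_
  · simp only [FF, integral_mul_const]
  · congr 1; funext ξ
    rw [← four2 hδ, ← integral_const_mul]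
    congr 1; funext x
    simp only [Prod.fst_add, Prod.snd_add]
    ring

lemma GG_scale (a : ℝ) {s : ℝ} (hs : 0 < s) (N M u : ℝ × ℝ) :
    GG (a * s ^ 2) N (M + s • u) = (s ^ 2)⁻¹ * GG a (s⁻¹ • (N - M)) u := by
  unfold GG
  have : -(Real.pi * (((M + s • u).1 - N.1) ^ 2 + ((M + s • u).2 - N.2) ^ 2)) / (a * s ^ 2) =
    -(Real.pi * ((u.1 - (s⁻¹ • (N - M)).1) ^ 2 + (u.2 - (s⁻¹ • (N - M)).2) ^ 2)) / a := by
    simp only [Prod.fst_add, Prod.snd_add, Prod.smul_fst, Prod.smul_snd, Prod.fst_sub,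
      Prod.snd_sub, smul_eq_mul]
    rcases eq_or_ne a 0 with rfl | ha
    · simp
    field_simp
    ring
  rw [this, mul_inv]; ring

lemma scaled (m : (ℝ × ℝ) × (ℝ × ℝ) → ℂ) (α β γ : ℝ) {s : ℝ} (hs : 0 < s) (J K N : ℝ × ℝ) :
    ((s ^ 2 : ℝ) : ℂ) * ∫ ξ : (ℝ × ℝ) × (ℝ × ℝ), m ξ * (GG (α * s ^ 2) J ξ.1 : ℂ) *
      (GG (β * s ^ 2) K ξ.2 : ℂ) * (GG (γ * s ^ 2) N (ξ.1 + ξ.2) : ℂ) =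
    ∫ u : (ℝ × ℝ) × (ℝ × ℝ), m ((J, K) + s • u) * (GG α 0 u.1 : ℂ) * (GG β 0 u.2 : ℂ) *
      (GG γ (s⁻¹ • (N - (J + K))) (u.1 + u.2) : ℂ) := by
  set f : (ℝ × ℝ) × (ℝ × ℝ) → ℂ := fun ξ => m ξ * (GG (α * s ^ 2) J ξ.1 : ℂ) *
      (GG (β * s ^ 2) K ξ.2 : ℂ) * (GG (γ * s ^ 2) N (ξ.1 + ξ.2) : ℂ) with hf
  have hd : Module.finrank ℝ ((ℝ × ℝ) × (ℝ × ℝ)) = 4 := by simp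
  have i0 : (volume : Measure (ℝ × ℝ)).IsAddHaarMeasure := by
    rw [Measure.volume_eq_prod]; infer_instance
  have i1 : (volume : Measure ((ℝ × ℝ) × (ℝ × ℝ))).IsAddHaarMeasure := by
    rw [Measure.volume_eq_prod]; infer_instance
  have h1 := Measure.integral_comp_smul (volume : Measure ((ℝ × ℝ) × (ℝ × ℝ)))
    (fun u => f ((J, K) + u)) s
  rw [integral_add_left_eq_self f, hd, abs_of_pos (by positivity)] at h1
  have h2 : ∫ ξ, f ξ = ((s ^ 4 : ℝ) : ℂ) * ∫ u, f ((J, K) + s • u) := by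
    rw [h1, Complex.real_smul, ← mul_assoc, ← Complex.ofReal_mul, mul_inv_cancel₀ (by positivity)]
    simp
  rw [h2, ← mul_assoc, ← integral_const_mul]
  congr 1; funext u
  simp only [hf]
  have e1 : ((J, K) + s • u).1 = J + s • u.1 := rfl
  have e2 : ((J, K) + s • u).2 = K + s • u.2 := rfl
  have e3 : J + s • u.1 + (K + s • u.2) = (J + K) + s • (u.1 + u.2) := by
    rw [smul_add]; abel
  rw [e1, e2, e3, GG_scale _ hs, GG_scale _ hs, GG_scale _ hs, sub_self, sub_self, smul_zero]
  have : (s : ℂ) ≠ 0 := by exact_mod_cast hs.ne'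
  push_cast
  field_simp

lemma conv1 {a b : ℝ} (ha : 0 < a) (hb : 0 < b) (w : ℝ) :
    ∫ v : ℝ, Real.exp (-(Real.pi * v ^ 2) / a) * Real.exp (-(Real.pi * (v - w) ^ 2) / b) =
      √(a * b / (a + b)) * Real.exp (-(Real.pi * w ^ 2) / (a + b)) := by
  have h := integral_gaussian (Real.pi * (a + b) / (a * b))
  rw [← integral_sub_right_eq_self _ (w * a / (a + b))] at h
  have e : Real.pi / (Real.pi * (a + b) / (a * b)) = a * b / (a + b) := by
    field_simp
  rw [e] at h
  rw [← h, ← integral_mul_const]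
  congr 1; funext v
  rw [← Real.exp_add, ← Real.exp_add]
  congr 1
  field_simp
  ring

lemma conv2 {a b : ℝ} (ha : 0 < a) (hb : 0 < b) (w : ℝ × ℝ) :
    ∫ v : ℝ × ℝ, GG a 0 v * GG b w v = GG (a + b) 0 w := by
  have h := integral_prod_mul (μ := (volume : Measure ℝ)) (ν := (volume : Measure ℝ))
    (fun v : ℝ => Real.exp (-(Real.pi * v ^ 2) / a) * Real.exp (-(Real.pi * (v - w.1) ^ 2) / b))
    (fun v : ℝ => Real.exp (-(Real.pi * v ^ 2) / a) * Real.exp (-(Real.pi * (v - w.2) ^ 2) / b))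
  rw [conv1 ha hb, conv1 ha hb, mul_mul_mul_comm, Real.mul_self_sqrt (by positivity),
    ← Real.exp_add] at h
  have e : GG (a + b) 0 w = (a⁻¹ * b⁻¹) * (a * b / (a + b) *
      Real.exp (-(Real.pi * w.1 ^ 2) / (a + b) + -(Real.pi * w.2 ^ 2) / (a + b))) := by
    have : -(Real.pi * w.1 ^ 2) / (a + b) + -(Real.pi * w.2 ^ 2) / (a + b) =
      -(Real.pi * (w.1 ^ 2 + w.2 ^ 2)) / (a + b) := by ring
    rw [this]
    unfold GG
    simp only [Prod.fst_zero, Prod.snd_zero, sub_zero]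
    field_simp
  rw [e, ← h, ← integral_const_mul, Measure.volume_eq_prod]
  congr 1; funext v
  unfold GG
  simp only [← Real.exp_add, Prod.fst_zero, Prod.snd_zero, sub_zero]
  rw [mul_mul_mul_comm, ← Real.exp_add]
  congr 2
  ring

lemma gauss_one {α β γ : ℝ} (hα : 0 < α) (hβ : 0 < β) (hγ : 0 < γ) (habc : α + β + γ = 1) :
    ∫ u : (ℝ × ℝ) × (ℝ × ℝ), GG α 0 u.1 * GG β 0 u.2 * GG γ 0 (u.1 + u.2) = 1 := by
  have hi : Integrable (fun u : (ℝ × ℝ) × (ℝ × ℝ) =>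
      GG α 0 u.1 * GG β 0 u.2 * GG γ 0 (u.1 + u.2)) := by
    refine ((dom_int hα hβ 0 0).const_mul γ⁻¹).mono' ?_ (Eventually.of_forall fun u => ?_)
    · have := GG_cont α 0
      have := GG_cont β 0
      have := GG_cont γ 0
      exact Continuous.aestronglyMeasurable (by fun_prop)
    · have h1 := GG_nonneg hα 0 u.1
      have h2 := GG_nonneg hβ 0 u.2
      have h3 := GG_nonneg hγ 0 (u.1 + u.2)
      rw [Real.norm_of_nonneg (by positivity), mul_comm]
      have h4 := GG_le hγ 0 (u.1 + u.2)
      have h5 : 1 ≤ Real.exp (l1 u) := Real.one_le_exp (by unfold l1; positivity)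
      gcongr
      nlinarith
  rw [Measure.volume_eq_prod, integral_prod _ (by rwa [Measure.volume_eq_prod] at hi)]
  have e : ∀ u : ℝ × ℝ, ∫ v : ℝ × ℝ, GG α 0 u * GG β 0 v * GG γ 0 (u + v) =
      GG α 0 u * GG (β + γ) 0 u := by
    intro u
    have e1 : GG (β + γ) 0 u = GG (β + γ) 0 (-u) := by unfold GG; simp
    rw [e1, ← conv2 hβ hγ, ← integral_const_mul]
    congr 1; funext v
    have : GG γ 0 (u + v) = GG γ (-u) v := by
      unfold GG; simp [add_comm]
    rw [this, mul_assoc]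
  simp only [e]
  rw [conv2 hα (by positivity), ← add_assoc, habc]
  simp [GG]

lemma GG_lim {γ : ℝ} (hγ : 0 < γ) (D w : ℝ × ℝ) :
    Tendsto (fun s : ℝ => GG γ (s⁻¹ • D) w) (nhdsWithin 0 (Set.Ioi 0))
      (nhds (if D = 0 then GG γ 0 w else 0)) := by
  split_ifs with hD
  · subst hD
    simp
  · have hD2 : 0 < D.1 ^ 2 + D.2 ^ 2 := by
      by_contra h
      apply hD
      have h1 : D.1 = 0 := by nlinarith [sq_nonneg D.1, sq_nonneg D.2]
      have h2 : D.2 = 0 := by nlinarith [sq_nonneg D.1, sq_nonneg D.2]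
      exact Prod.ext h1 h2
    have hr : Tendsto (fun s : ℝ => s⁻¹) (nhdsWithin 0 (Set.Ioi 0)) atTop :=
      tendsto_inv_nhdsGT_zero
    have hr2 : Tendsto (fun s : ℝ => (s⁻¹) ^ 2) (nhdsWithin 0 (Set.Ioi 0)) atTop :=
      (tendsto_pow_atTop two_ne_zero).comp hr
    have h3 : Tendsto (fun s : ℝ => γ⁻¹ * (Real.exp (-((Real.pi * (D.1 ^ 2 + D.2 ^ 2) / (2 * γ)) * (s⁻¹) ^ 2)) *
        Real.exp (Real.pi * (w.1 ^ 2 + w.2 ^ 2) / γ)))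
        (nhdsWithin 0 (Set.Ioi 0)) (nhds (γ⁻¹ * (0 * Real.exp (Real.pi * (w.1 ^ 2 + w.2 ^ 2) / γ)))) := by
      refine Tendsto.const_mul _ (Tendsto.mul_const _ ?_)
      exact Real.tendsto_exp_neg_atTop_nhds_zero.comp (hr2.const_mul_atTop (by positivity))
    rw [zero_mul, mul_zero] at h3
    refine squeeze_zero (fun s => GG_nonneg hγ _ _) (fun s => ?_) h3
    unfold GG
    rw [← Real.exp_add]
    gcongr
    simp only [Prod.smul_fst, Prod.smul_snd, smul_eq_mul]
    have e : -(Real.pi * (D.1 ^ 2 + D.2 ^ 2) / (2 * γ) * s⁻¹ ^ 2) + Real.pi * (w.1 ^ 2 + w.2 ^ 2) / γ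
      = -(Real.pi * ((D.1 ^ 2 + D.2 ^ 2) * s⁻¹ ^ 2 / 2 - (w.1 ^ 2 + w.2 ^ 2))) / γ := by
      field_simp; ring
    rw [e]
    gcongr
    nlinarith [sq_nonneg (s⁻¹ * D.1 - 2 * w.1), sq_nonneg (s⁻¹ * D.2 - 2 * w.2)]

lemma main_lim (m : (ℝ × ℝ) × (ℝ × ℝ) → ℂ) (hm : Measurable m) (C : ℝ) (hC : 0 < C)
    (hg : ∀ ξ, ‖m ξ‖ ≤ C * Real.exp (l1 ξ)) {α β γ : ℝ} (hα : 0 < α) (hβ : 0 < β) (hγ : 0 < γ)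
    (habc : α + β + γ = 1) (J K N : ℝ × ℝ) (hc : ContinuousAt m (J, K)) :
    Tendsto (fun s : ℝ => ∫ u : (ℝ × ℝ) × (ℝ × ℝ),
      m ((J, K) + s • u) * (GG α 0 u.1 : ℂ) * (GG β 0 u.2 : ℂ) *
      (GG γ (s⁻¹ • (N - (J + K))) (u.1 + u.2) : ℂ)) (nhdsWithin 0 (Set.Ioi 0))
      (nhds (if N - (J + K) = 0 then m (J, K) else 0)) := by
  have key : (∫ u : (ℝ × ℝ) × (ℝ × ℝ), m (J, K) * (GG α 0 u.1 : ℂ) * (GG β 0 u.2 : ℂ) *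
      ((if N - (J + K) = 0 then GG γ 0 (u.1 + u.2) else 0 : ℝ) : ℂ)) =
      if N - (J + K) = 0 then m (J, K) else 0 := by
    split_ifs with h
    · have h1 := gauss_one hα hβ hγ habc
      have h2 : (∫ u : (ℝ × ℝ) × (ℝ × ℝ),
        ((GG α 0 u.1 * GG β 0 u.2 * GG γ 0 (u.1 + u.2) : ℝ) : ℂ)) = 1 := by
        rw [integral_complex_ofReal, h1]; simp
      calc _ = m (J, K) * ∫ u : (ℝ × ℝ) × (ℝ × ℝ),
            ((GG α 0 u.1 * GG β 0 u.2 * GG γ 0 (u.1 + u.2) : ℝ) : ℂ) := by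
            rw [← integral_const_mul]
            congr 1; funext u; push_cast; ring
        _ = _ := by rw [h2, mul_one]
    · simp
  rw [← key]
  refine tendsto_integral_filter_of_dominated_convergence
    (fun u => (C * Real.exp (l1 (J, K)) * γ⁻¹) * (Real.exp (l1 u) * GG α 0 u.1 * GG β 0 u.2))
    ?_ ?_ ((dom_int hα hβ 0 0).const_mul _) ?_
  · refine Eventually.of_forall fun s => ?_
    have h1 := (GG_cont α 0).measurable
    have h2 := (GG_cont β 0).measurable
    have h3 := (GG_cont γ (s⁻¹ • (N - (J + K)))).measurable
    exact Measurable.aestronglyMeasurable (by fun_prop)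
  · have h1 : ∀ᶠ s : ℝ in nhdsWithin 0 (Set.Ioi 0), s ∈ Set.Ioo (0 : ℝ) 1 :=
      Ioo_mem_nhdsGT one_pos
    filter_upwards [h1] with s hs
    refine Eventually.of_forall fun u => ?_
    have g1 := GG_nonneg hα 0 u.1
    have g2 := GG_nonneg hβ 0 u.2
    have g3 := GG_nonneg hγ (s⁻¹ • (N - (J + K))) (u.1 + u.2)
    have g4 := GG_le hγ (s⁻¹ • (N - (J + K))) (u.1 + u.2)
    rw [norm_mul, norm_mul, norm_mul, Complex.norm_real, Complex.norm_real, Complex.norm_real,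
      Real.norm_of_nonneg g1, Real.norm_of_nonneg g2, Real.norm_of_nonneg g3]
    have habs : ∀ p q : ℝ, |p + s * q| ≤ |p| + |q| := by
      intro p q
      refine (abs_add_le _ _).trans ?_
      rw [abs_mul, abs_of_pos hs.1]
      have := abs_nonneg q
      have := hs.2
      nlinarith
    have hl : l1 ((J, K) + s • u) ≤ l1 (J, K) + l1 u := by
      have a1 := habs J.1 u.1.1
      have a2 := habs J.2 u.1.2
      have a3 := habs K.1 u.2.1
      have a4 := habs K.2 u.2.2
      simp only [l1, Prod.fst_add, Prod.snd_add, Prod.smul_fst, Prod.smul_snd, smul_eq_mul]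
      linarith
    have hmb : ‖m ((J, K) + s • u)‖ ≤ C * (Real.exp (l1 (J, K)) * Real.exp (l1 u)) := by
      refine (hg _).trans ?_
      rw [← Real.exp_add]
      gcongr
    calc _ ≤ C * (Real.exp (l1 (J, K)) * Real.exp (l1 u)) * GG α 0 u.1 * GG β 0 u.2 * γ⁻¹ := by
          gcongr
      _ = _ := by ring
  · refine Eventually.of_forall fun u => ?_
    refine Tendsto.mul (Tendsto.mul_const _ (Tendsto.mul_const _ ?_)) ?_
    · have h0 : Tendsto (fun s : ℝ => (J, K) + s • u) (nhdsWithin 0 (Set.Ioi 0)) (nhds (J, K)) := by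
        have : Continuous (fun s : ℝ => (J, K) + s • u) := by fun_prop
        have h := this.tendsto 0
        rw [zero_smul, add_zero] at h
        exact h.mono_left nhdsWithin_le_nhds
      exact hc.tendsto.comp h0
    · exact (Complex.continuous_ofReal.tendsto _).comp (GG_lim hγ _ _)

lemma FF_lim (m : (ℝ × ℝ) × (ℝ × ℝ) → ℂ) (hm : Measurable m) (C : ℝ) (hC : 0 < C)
    (hg : ∀ ξ, ‖m ξ‖ ≤ C * Real.exp (l1 ξ)) {α β γ : ℝ} (hα : 0 < α) (hβ : 0 < β) (hγ : 0 < γ)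
    (habc : α + β + γ = 1) (J K N : ℝ × ℝ) (hc : ContinuousAt m (J, K)) :
    Tendsto (fun ε : ℝ => (ε : ℂ) * ∫ x, FF m (α * ε) (β * ε) (γ * ε) J K N x)
      (nhdsWithin 0 (Set.Ioi 0)) (nhds (if N - (J + K) = 0 then m (J, K) else 0)) := by
  have hs : Tendsto Real.sqrt (nhdsWithin 0 (Set.Ioi 0)) (nhdsWithin 0 (Set.Ioi 0)) := by
    refine tendsto_nhdsWithin_iff.mpr ⟨?_, ?_⟩
    · have := Real.continuous_sqrt.tendsto 0
      rw [Real.sqrt_zero] at this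
      exact this.mono_left nhdsWithin_le_nhds
    · filter_upwards [self_mem_nhdsWithin] with ε hε
      exact Real.sqrt_pos.mpr hε
  refine ((main_lim m hm C hC hg hα hβ hγ habc J K N hc).comp hs).congr' ?_
  filter_upwards [self_mem_nhdsWithin] with ε hε
  have hε : 0 < ε := hε
  have h1 := scaled m α β γ (Real.sqrt_pos.mpr hε) J K N
  rw [Real.sq_sqrt hε.le] at h1
  rw [FF_integral m hm C hg (by positivity) (by positivity) (by positivity), h1]
  rfl

lemma EE_int1 (p : ℤ) : ∫ x in Set.Icc (0 : ℝ) 1, EE ((p : ℝ) * x) = if p = 0 then 1 else 0 := by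
  rw [integral_Icc_eq_integral_Ioc, ← intervalIntegral.integral_of_le zero_le_one]
  split_ifs with h
  · subst h; simp [EE]
  · have hc : (2 * Real.pi * Complex.I * p : ℂ) ≠ 0 := by
      simp [Real.pi_ne_zero, h]
    have := integral_exp_mul_complex (a := 0) (b := 1) hc
    have e : ∀ x : ℝ, EE ((p : ℝ) * x) = Complex.exp (2 * Real.pi * Complex.I * p * x) := by
      intro x; unfold EE; push_cast; ring_nf
    simp only [e, this]
    have : Complex.exp (2 * Real.pi * Complex.I * p * ((1 : ℝ) : ℂ)) = 1 := by
      rw [Complex.exp_eq_one_iff]; exact ⟨p, by push_cast; ring⟩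
    rw [this]; simp

lemma EE_int2 (p q : ℤ) : ∫ x in Set.Icc (0 : ℝ) 1 ×ˢ Set.Icc (0 : ℝ) 1,
    EE ((p : ℝ) * x.1 + (q : ℝ) * x.2) = if p = 0 ∧ q = 0 then 1 else 0 := by
  have h := setIntegral_prod_mul (μ := (volume : Measure ℝ)) (ν := (volume : Measure ℝ))
    (fun x : ℝ => EE ((p : ℝ) * x)) (fun x : ℝ => EE ((q : ℝ) * x)) (Set.Icc 0 1) (Set.Icc 0 1)
  rw [EE_int1, EE_int1] at h
  simp only [EE_add]
  rw [Measure.volume_eq_prod, h]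
  by_cases hp : p = 0 <;> by_cases hq : q = 0 <;> simp [hp, hq]

/-- integer point as a real point -/
noncomputable def rp (j : ℤ × ℤ) : ℝ × ℝ := ((j.1 : ℝ), (j.2 : ℝ))

lemma trigSum_eq (c : ℤ × ℤ → ℂ) (hc : (Function.support c).Finite) (x : ℝ × ℝ) :
    trigSum c x = ∑ n ∈ hc.toFinset, c n * EE ((rp n).1 * x.1 + (rp n).2 * x.2) := by
  unfold trigSum
  rw [tsum_eq_sum (s := hc.toFinset)]
  · rfl
  · intro n hn
    have : c n = 0 := by simpa using hn
    simp [this]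

lemma gaussApprox_eq (c : ℤ × ℤ → ℂ) (hc : (Function.support c).Finite) (δ : ℝ) (x : ℝ × ℝ) :
    gaussApprox c δ x = ∑ n ∈ hc.toFinset, c n * (GG δ (rp n) x : ℂ) := by
  unfold gaussApprox
  rw [tsum_eq_sum (s := hc.toFinset)]
  · rfl
  · intro n hn
    have : c n = 0 := by simpa using hn
    simp [this]

lemma double_eq (m : (ℝ × ℝ) × (ℝ × ℝ) → ℂ) (P Q : ℤ × ℤ → ℂ) (hP : (Function.support P).Finite)
    (hQ : (Function.support Q).Finite) (x : ℝ × ℝ) :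
    (∑' j : ℤ × ℤ, ∑' k : ℤ × ℤ,
            m (((j.1 : ℝ), (j.2 : ℝ)), ((k.1 : ℝ), (k.2 : ℝ))) * P j * Q k *
              Complex.exp (2 * Real.pi * Complex.I *
                ((((j.1 : ℝ) + (k.1 : ℝ)) * x.1 + ((j.2 : ℝ) + (k.2 : ℝ)) * x.2 : ℝ) : ℂ))) =
    ∑ j ∈ hP.toFinset, ∑ k ∈ hQ.toFinset, m (rp j, rp k) * P j * Q k *
      EE (((j.1 : ℝ) + (k.1 : ℝ)) * x.1 + ((j.2 : ℝ) + (k.2 : ℝ)) * x.2) := by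
  rw [tsum_eq_sum (s := hP.toFinset)]
  · refine Finset.sum_congr rfl fun j _ => ?_
    rw [tsum_eq_sum (s := hQ.toFinset)]
    · rfl
    · intro n hn
      have : Q n = 0 := by simpa using hn
      simp [this]
  · intro n hn
    have : P n = 0 := by simpa using hn
    simp [this]

lemma rhs_eq (m : (ℝ × ℝ) × (ℝ × ℝ) → ℂ) (P Q R : ℤ × ℤ → ℂ) (hP : (Function.support P).Finite)
    (hQ : (Function.support Q).Finite) (hR : (Function.support R).Finite) :
    (∫ x in Set.Icc (0 : ℝ) 1 ×ˢ Set.Icc (0 : ℝ) 1,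
        (∑' j : ℤ × ℤ, ∑' k : ℤ × ℤ,
            m (((j.1 : ℝ), (j.2 : ℝ)), ((k.1 : ℝ), (k.2 : ℝ))) * P j * Q k *
              Complex.exp (2 * Real.pi * Complex.I *
                ((((j.1 : ℝ) + (k.1 : ℝ)) * x.1 + ((j.2 : ℝ) + (k.2 : ℝ)) * x.2 : ℝ) : ℂ))) *
        (starRingEnd ℂ) (trigSum R x)) =
    ∑ j ∈ hP.toFinset, ∑ k ∈ hQ.toFinset, ∑ n ∈ hR.toFinset,
      (P j * Q k * (starRingEnd ℂ) (R n)) *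
        (if rp n - (rp j + rp k) = 0 then m (rp j, rp k) else 0) := by
  have e : ∀ x : ℝ × ℝ, (∑' j : ℤ × ℤ, ∑' k : ℤ × ℤ,
            m (((j.1 : ℝ), (j.2 : ℝ)), ((k.1 : ℝ), (k.2 : ℝ))) * P j * Q k *
              Complex.exp (2 * Real.pi * Complex.I *
                ((((j.1 : ℝ) + (k.1 : ℝ)) * x.1 + ((j.2 : ℝ) + (k.2 : ℝ)) * x.2 : ℝ) : ℂ))) *
        (starRingEnd ℂ) (trigSum R x) =
      ∑ j ∈ hP.toFinset, ∑ k ∈ hQ.toFinset, ∑ n ∈ hR.toFinset,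
      (P j * Q k * (starRingEnd ℂ) (R n) * m (rp j, rp k)) *
        EE (((j.1 + k.1 - n.1 : ℤ) : ℝ) * x.1 + ((j.2 + k.2 - n.2 : ℤ) : ℝ) * x.2) := by
    intro x
    rw [double_eq m P Q hP hQ, trigSum_eq R hR, map_sum, Finset.sum_mul]
    refine Finset.sum_congr rfl fun j _ => ?_
    rw [Finset.sum_mul]
    refine Finset.sum_congr rfl fun k _ => ?_
    rw [Finset.mul_sum]
    refine Finset.sum_congr rfl fun n _ => ?_
    rw [map_mul, EE_conj]
    have : ((j.1 + k.1 - n.1 : ℤ) : ℝ) * x.1 + ((j.2 + k.2 - n.2 : ℤ) : ℝ) * x.2 =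
      (((j.1 : ℝ) + (k.1 : ℝ)) * x.1 + ((j.2 : ℝ) + (k.2 : ℝ)) * x.2) +
        (-((rp n).1 * x.1 + (rp n).2 * x.2)) := by
      simp only [rp]; push_cast; ring
    rw [this, EE_add ((((j.1 : ℝ) + (k.1 : ℝ)) * x.1 + ((j.2 : ℝ) + (k.2 : ℝ)) * x.2))]
    generalize EE (((j.1 : ℝ) + (k.1 : ℝ)) * x.1 + ((j.2 : ℝ) + (k.2 : ℝ)) * x.2) = A
    generalize EE (-((rp n).1 * x.1 + (rp n).2 * x.2)) = B
    ring
  simp only [e]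
  have hI : ∀ (c : ℂ) (p q : ℤ), IntegrableOn (fun x : ℝ × ℝ => c * EE ((p : ℝ) * x.1 + (q : ℝ) * x.2))
      (Set.Icc (0 : ℝ) 1 ×ˢ Set.Icc (0 : ℝ) 1) := by
    intro c p q
    have := EE_cont
    exact ContinuousOn.integrableOn_compact (isCompact_Icc.prod isCompact_Icc)
      (Continuous.continuousOn (by fun_prop))
  rw [integral_finsetSum _ (fun j _ => integrable_finsetSum _ fun k _ =>
    integrable_finsetSum _ fun n _ => hI _ _ _)]
  refine Finset.sum_congr rfl fun j _ => ?_
  rw [integral_finsetSum _ (fun k _ => integrable_finsetSum _ fun n _ => hI _ _ _)]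
  refine Finset.sum_congr rfl fun k _ => ?_
  rw [integral_finsetSum _ (fun n _ => hI _ _ _)]
  refine Finset.sum_congr rfl fun n _ => ?_
  rw [integral_const_mul, EE_int2]
  have : rp n - (rp j + rp k) = 0 ↔ (j.1 + k.1 - n.1 = 0 ∧ j.2 + k.2 - n.2 = 0) := by
    simp only [rp, Prod.ext_iff, Prod.fst_sub, Prod.snd_sub, Prod.fst_add, Prod.snd_add,
      Prod.fst_zero, Prod.snd_zero]
    norm_cast
    constructor <;> rintro ⟨h1, h2⟩ <;> constructor <;> omega
  simp only [this]
  split_ifs <;> simp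

lemma lhs_eq (m : (ℝ × ℝ) × (ℝ × ℝ) → ℂ) (hm : Measurable m) (C : ℝ)
    (hg : ∀ ξ, ‖m ξ‖ ≤ C * Real.exp (l1 ξ)) {a b δ : ℝ} (ha : 0 < a) (hb : 0 < b) (hδ : 0 < δ)
    (P Q R : ℤ × ℤ → ℂ) (hP : (Function.support P).Finite)
    (hQ : (Function.support Q).Finite) (hR : (Function.support R).Finite) :
    (∫ x : ℝ × ℝ,
          (∫ ξ : (ℝ × ℝ) × (ℝ × ℝ),
            m ξ * gaussApprox P a ξ.1 * gaussApprox Q b ξ.2 *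
              EE ((ξ.1.1 + ξ.2.1) * x.1 + (ξ.1.2 + ξ.2.2) * x.2)) *
          (starRingEnd ℂ) (trigSum R x) * (WW δ x : ℂ)) =
    ∑ j ∈ hP.toFinset, ∑ k ∈ hQ.toFinset, ∑ n ∈ hR.toFinset,
      (P j * Q k * (starRingEnd ℂ) (R n)) * ∫ x, FF m a b δ (rp j) (rp k) (rp n) x := by
  have e : ∀ x : ℝ × ℝ, (∫ ξ : (ℝ × ℝ) × (ℝ × ℝ),
            m ξ * gaussApprox P a ξ.1 * gaussApprox Q b ξ.2 *
              EE ((ξ.1.1 + ξ.2.1) * x.1 + (ξ.1.2 + ξ.2.2) * x.2)) *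
          (starRingEnd ℂ) (trigSum R x) * (WW δ x : ℂ) =
      ∑ j ∈ hP.toFinset, ∑ k ∈ hQ.toFinset, ∑ n ∈ hR.toFinset,
      (P j * Q k * (starRingEnd ℂ) (R n)) * FF m a b δ (rp j) (rp k) (rp n) x := by
    intro x
    have e1 : ∀ ξ : (ℝ × ℝ) × (ℝ × ℝ), m ξ * gaussApprox P a ξ.1 * gaussApprox Q b ξ.2 *
              EE ((ξ.1.1 + ξ.2.1) * x.1 + (ξ.1.2 + ξ.2.2) * x.2) =
        ∑ j ∈ hP.toFinset, ∑ k ∈ hQ.toFinset, (P j * Q k) *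
          (m ξ * (GG a (rp j) ξ.1 : ℂ) * (GG b (rp k) ξ.2 : ℂ) *
            EE ((ξ.1.1 + ξ.2.1) * x.1 + (ξ.1.2 + ξ.2.2) * x.2)) := by
      intro ξ
      rw [gaussApprox_eq P hP, gaussApprox_eq Q hQ,
        Finset.mul_sum hP.toFinset, Finset.sum_mul, Finset.sum_mul]
      refine Finset.sum_congr rfl fun j _ => ?_
      rw [Finset.mul_sum, Finset.sum_mul]
      refine Finset.sum_congr rfl fun k _ => ?_
      ring
    have hI : ∀ (c : ℂ) (J K : ℝ × ℝ), Integrable (fun ξ : (ℝ × ℝ) × (ℝ × ℝ) => c *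
          (m ξ * (GG a J ξ.1 : ℂ) * (GG b K ξ.2 : ℂ) *
            EE ((ξ.1.1 + ξ.2.1) * x.1 + (ξ.1.2 + ξ.2.2) * x.2))) := by
      intro c J K
      refine Integrable.const_mul ?_ c
      refine (mGG_int m hm C hg ha hb J K).mul_bdd (c := 1) ?_ ?_
      · have := EE_cont
        exact Continuous.aestronglyMeasurable (by fun_prop)
      · exact Eventually.of_forall fun ξ => (EE_norm _).le
    simp only [e1]
    rw [integral_finsetSum _ (fun j _ => integrable_finsetSum _ fun k _ => hI _ _ _),
      Finset.sum_mul, Finset.sum_mul]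
    refine Finset.sum_congr rfl fun j _ => ?_
    rw [integral_finsetSum _ (fun k _ => hI _ _ _), Finset.sum_mul, Finset.sum_mul]
    refine Finset.sum_congr rfl fun k _ => ?_
    rw [integral_const_mul, trigSum_eq R hR, map_sum, Finset.mul_sum, Finset.sum_mul]
    refine Finset.sum_congr rfl fun n _ => ?_
    rw [map_mul]
    unfold FF
    ring
  simp only [e]
  have hI : ∀ (c : ℂ) (J K N : ℝ × ℝ), Integrable (fun x => c * FF m a b δ J K N x) :=
    fun c J K N => (FF_int m hm C hg ha hb hδ J K N).const_mul c
  rw [integral_finsetSum _ (fun j _ => integrable_finsetSum _ fun k _ =>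
    integrable_finsetSum _ fun n _ => hI _ _ _ _)]
  refine Finset.sum_congr rfl fun j _ => ?_
  rw [integral_finsetSum _ (fun k _ => integrable_finsetSum _ fun n _ => hI _ _ _ _)]
  refine Finset.sum_congr rfl fun k _ => ?_
  rw [integral_finsetSum _ (fun n _ => hI _ _ _ _)]
  refine Finset.sum_congr rfl fun n _ => ?_
  rw [integral_const_mul]

/-- the transference limit (Lemma 3.6). For a measurable symbol `m`
continuous at lattice points and of at most exponential growth, trigonometric
polynomials `P, Q, R`, and `α, β, γ > 0` with `α + β + γ = 1`,
`ε·∫_{ℝ²} π(Pw_{αε}, Qw_{βε})(x) conj(R(x)) w_{γε}(x) dx` converges, as `ε → 0⁺`,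
to `∫_{[0,1]²} π̃(P,Q)(x) conj(R(x)) dx`. -/
theorem stmt_9 (m : (ℝ × ℝ) × (ℝ × ℝ) → ℂ) (hm : Measurable m)
    (hcont : ∀ j k : ℤ × ℤ,
      ContinuousAt m (((j.1 : ℝ), (j.2 : ℝ)), ((k.1 : ℝ), (k.2 : ℝ))))
    (C₀ : ℝ) (hC₀ : 0 < C₀)
    (hgrowth : ∀ ξ : (ℝ × ℝ) × (ℝ × ℝ),
      ‖m ξ‖ ≤ C₀ * Real.exp (Real.sqrt (ξ.1.1 ^ 2 + ξ.1.2 ^ 2 + ξ.2.1 ^ 2 + ξ.2.2 ^ 2)))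
    (P Q R : ℤ × ℤ → ℂ) (hP : (Function.support P).Finite)
    (hQ : (Function.support Q).Finite) (hR : (Function.support R).Finite)
    (α β γ : ℝ) (hα : 0 < α) (hβ : 0 < β) (hγ : 0 < γ) (habc : α + β + γ = 1) :
    Tendsto
      (fun ε : ℝ => (ε : ℂ) *
        ∫ x : ℝ × ℝ,
          (∫ ξ : (ℝ × ℝ) × (ℝ × ℝ),
            m ξ * gaussApprox P (α * ε) ξ.1 * gaussApprox Q (β * ε) ξ.2 *
              Complex.exp (2 * Real.pi * Complex.I *
                (((ξ.1.1 + ξ.2.1) * x.1 + (ξ.1.2 + ξ.2.2) * x.2 : ℝ) : ℂ))) *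
          (starRingEnd ℂ) (trigSum R x) *
          ((Real.exp (-(Real.pi * (γ * ε) * (x.1 ^ 2 + x.2 ^ 2))) : ℝ) : ℂ))
      (nhdsWithin 0 (Set.Ioi 0))
      (nhds (∫ x in Set.Icc (0 : ℝ) 1 ×ˢ Set.Icc (0 : ℝ) 1,
        (∑' j : ℤ × ℤ, ∑' k : ℤ × ℤ,
            m (((j.1 : ℝ), (j.2 : ℝ)), ((k.1 : ℝ), (k.2 : ℝ))) * P j * Q k *
              Complex.exp (2 * Real.pi * Complex.I *
                ((((j.1 : ℝ) + (k.1 : ℝ)) * x.1 + ((j.2 : ℝ) + (k.2 : ℝ)) * x.2 : ℝ) : ℂ))) *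
        (starRingEnd ℂ) (trigSum R x))) := by
  have hg : ∀ ξ, ‖m ξ‖ ≤ C₀ * Real.exp (l1 ξ) := by
    intro ξ
    refine (hgrowth ξ).trans ?_
    gcongr
    unfold l1
    refine Real.sqrt_le_iff.mpr ⟨by positivity, ?_⟩
    have a1 := abs_nonneg ξ.1.1
    have a2 := abs_nonneg ξ.1.2
    have a3 := abs_nonneg ξ.2.1
    have a4 := abs_nonneg ξ.2.2
    rw [← sq_abs ξ.1.1, ← sq_abs ξ.1.2, ← sq_abs ξ.2.1, ← sq_abs ξ.2.2]
    have := mul_nonneg a1 a2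
    have := mul_nonneg a1 a3
    have := mul_nonneg a1 a4
    have := mul_nonneg a2 a3
    have := mul_nonneg a2 a4
    have := mul_nonneg a3 a4
    nlinarith
  rw [rhs_eq m P Q R hP hQ hR]
  have hlim : Tendsto (fun ε : ℝ => ∑ j ∈ hP.toFinset, ∑ k ∈ hQ.toFinset, ∑ n ∈ hR.toFinset,
      (P j * Q k * (starRingEnd ℂ) (R n)) * ((ε : ℂ) *
        ∫ x, FF m (α * ε) (β * ε) (γ * ε) (rp j) (rp k) (rp n) x))
      (nhdsWithin 0 (Set.Ioi 0))
      (nhds (∑ j ∈ hP.toFinset, ∑ k ∈ hQ.toFinset, ∑ n ∈ hR.toFinset,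
      (P j * Q k * (starRingEnd ℂ) (R n)) *
        (if rp n - (rp j + rp k) = 0 then m (rp j, rp k) else 0))) :=
    tendsto_finsetSum _ fun j _ => tendsto_finsetSum _ fun k _ => tendsto_finsetSum _ fun n _ =>
      (FF_lim m hm C₀ hC₀ hg hα hβ hγ habc (rp j) (rp k) (rp n) (hcont j k)).const_mul _
  refine hlim.congr' ?_
  filter_upwards [self_mem_nhdsWithin] with ε hε
  have hε : 0 < ε := hε
  have h := lhs_eq m hm C₀ hg (a := α * ε) (b := β * ε) (δ := γ * ε) (by positivity)
    (by positivity) (by positivity) P Q R hP hQ hR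
  refine Eq.trans ?_ (congrArg (fun z => (ε : ℂ) * z) h.symm)
  simp only [Finset.mul_sum]
  refine Finset.sum_congr rfl fun j _ => Finset.sum_congr rfl fun k _ =>
    Finset.sum_congr rfl fun n _ => ?_
  ring
end

section
/- Let P be a trigonometric polynomial on 𝕋² with coefficients P̂ : ℤ² → ℂ, let s ≥ 0 be real, α > 0 and 2 ≤ p < ∞. For ε > 0 define u_ε : ℝ² → ℂ by u_ε(x) = ∫_{ℝ²} (1 + ξ₁²)^{s/2}·[Σ_{m∈ℤ²} P̂(m)(αε)^{−1}e^{−π‖ξ−m‖²/(αε)}]·e^{2πi ξ·x} dξ, where ξ = (ξ₁, ξ₂). Then lim_{ε→0⁺} ε^{1/p}·‖u_ε‖_{L^p(ℝ²)} = (pα)^{−1/p}·‖Λ^s P‖_{L^p([0,1]²)}, where Λ^s P(x) = Σ_{m∈ℤ²} (1 + m₁²)^{s/2}·P̂(m)·e^{2πi m·x}. -/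
open scoped Real
open MeasureTheory Filter

/-- The weighted Gaussian profile. -/
noncomputable def gG (s M r t : ℝ) : ℝ :=
  (1 + (M + r * t) ^ 2) ^ (s / 2) * Real.exp (-(Real.pi * t ^ 2))

/-- The character `e^{2πi a}`. -/
noncomputable def ee (a : ℝ) : ℂ := Complex.exp (2 * Real.pi * Complex.I * (a : ℂ))

/-- One-dimensional inverse Fourier transform of the profile. -/
noncomputable def AA (s M r y : ℝ) : ℂ := ∫ t : ℝ, (gG s M r t : ℂ) * ee (t * y)

lemma norm_ee (a : ℝ) : ‖ee a‖ = 1 := by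
  unfold ee
  rw [show (2 * Real.pi * Complex.I * (a : ℂ)) = ((2 * Real.pi * a : ℝ) : ℂ) * Complex.I by
    push_cast; ring]
  exact Complex.norm_exp_ofReal_mul_I _

lemma ee_add (a b : ℝ) : ee (a + b) = ee a * ee b := by
  unfold ee; rw [← Complex.exp_add]; push_cast; ring_nf

lemma ee_int (n : ℤ) : ee n = 1 := by
  unfold ee
  rw [Complex.exp_eq_one_iff]
  exact ⟨n, by push_cast; ring⟩

lemma continuous_ee : Continuous ee := by unfold ee; fun_prop

lemma gG_nonneg (s M r t : ℝ) : 0 ≤ gG s M r t := by unfold gG; positivity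

lemma gG_cont (s M : ℝ) : Continuous (fun q : ℝ × ℝ => gG s M q.1 q.2) := by
  unfold gG
  refine Continuous.mul ?_ (by fun_prop)
  refine Continuous.rpow_const (by fun_prop) ?_
  intro x; left; positivity

/-- crude growth bound -/
lemma gG_le {s : ℝ} (hs : 0 ≤ s) (M r t : ℝ) (hr : |r| ≤ 1) :
    gG s M r t ≤ Real.exp (s * |M| + s ^ 2 / 4) * Real.exp (-(2 * t ^ 2)) := by
  have h1 : 1 + (M + r * t) ^ 2 ≤ Real.exp (2 * (|M| + |t|)) := by
    have h2 : |M + r * t| ≤ |M| + |t| := by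
      calc |M + r * t| ≤ |M| + |r * t| := abs_add_le _ _
        _ = |M| + |r| * |t| := by rw [abs_mul]
        _ ≤ |M| + |t| := by nlinarith [abs_nonneg t]
    have h3 : 1 + (|M| + |t|) ≤ Real.exp (|M| + |t|) := by
      linarith [Real.add_one_le_exp (|M| + |t|)]
    have h4 : Real.exp (2 * (|M| + |t|)) = Real.exp (|M| + |t|) ^ 2 := by
      rw [← Real.exp_nat_mul]; norm_num
    rw [h4, ← sq_abs (M + r * t)]
    have := abs_nonneg (M + r * t)
    nlinarith
  have h2 : (1 + (M + r * t) ^ 2) ^ (s / 2) ≤ Real.exp (s * (|M| + |t|)) := by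
    calc _ ≤ (Real.exp (2 * (|M| + |t|))) ^ (s / 2) :=
          Real.rpow_le_rpow (by positivity) h1 (by positivity)
      _ = _ := by rw [← Real.exp_mul]; congr 1; ring
  unfold gG
  calc _ ≤ Real.exp (s * (|M| + |t|)) * Real.exp (-(Real.pi * t ^ 2)) := by gcongr
    _ = Real.exp (s * (|M| + |t|) - Real.pi * t ^ 2) := by rw [← Real.exp_add]; ring_nf
    _ ≤ _ := by
      rw [← Real.exp_add, Real.exp_le_exp]
      have := Real.pi_gt_three
      nlinarith [sq_nonneg (s / 2 - |t|), sq_abs t, sq_nonneg t]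

/-- derivative of the profile -/
noncomputable def gG' (s M r t : ℝ) : ℝ :=
  (2 * (M + r * t) * r * (s / 2) * (1 + (M + r * t) ^ 2) ^ (s / 2 - 1)) *
    Real.exp (-(Real.pi * t ^ 2)) +
  (1 + (M + r * t) ^ 2) ^ (s / 2) * (Real.exp (-(Real.pi * t ^ 2)) * (-(Real.pi * (2 * t))))

lemma gG_hasDeriv (s M r t : ℝ) : HasDerivAt (gG s M r) (gG' s M r t) t := by
  unfold gG gG'
  have h0 : HasDerivAt (fun t : ℝ => M + r * t) r t := by
    simpa using ((hasDerivAt_id t).const_mul r).const_add M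
  have h1 : HasDerivAt (fun t : ℝ => 1 + (M + r * t) ^ 2) (2 * (M + r * t) * r) t := by
    simpa using (h0.pow 2).const_add 1
  have h2 := h1.rpow_const (p := s / 2) (Or.inl (by positivity))
  have h3 : HasDerivAt (fun t : ℝ => -(Real.pi * t ^ 2)) (-(Real.pi * (2 * t))) t := by
    have h := (((hasDerivAt_id t).pow 2).const_mul Real.pi).neg
    simp only [id, Nat.cast_ofNat, mul_one, Nat.add_one_sub_one, pow_one] at h
    exact h
  exact h2.mul h3.exp

lemma gG'_le {s : ℝ} (hs : 0 ≤ s) (M r t : ℝ) (hr : |r| ≤ 1) :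
    |gG' s M r t| ≤ (s / 2 + 2 * Real.pi) * Real.exp (s * |M| + s ^ 2 / 4) *
      (Real.exp 1 * Real.exp (-(t ^ 2))) := by
  have hx : |2 * (M + r * t)| ≤ 1 + (M + r * t) ^ 2 := by
    rw [abs_le]; constructor <;> nlinarith [sq_nonneg (M + r * t + 1), sq_nonneg (M + r * t - 1)]
  have hpos : 0 < 1 + (M + r * t) ^ 2 := by positivity
  have e1 : |gG' s M r t| ≤ (s / 2 + 2 * Real.pi * |t|) * gG s M r t := by
    unfold gG' gG
    refine (abs_add_le _ _).trans ?_
    rw [add_mul]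
    refine add_le_add ?_ ?_
    · rw [abs_mul, abs_mul, abs_mul, abs_mul, abs_of_nonneg (Real.exp_pos _).le,
        abs_of_nonneg (Real.rpow_nonneg hpos.le _), abs_of_nonneg (by positivity : 0 ≤ s / 2),
        ← mul_assoc]
      refine mul_le_mul_of_nonneg_right ?_ (Real.exp_pos _).le
      calc |2 * (M + r * t)| * |r| * (s / 2) * (1 + (M + r * t) ^ 2) ^ (s / 2 - 1)
          ≤ (1 + (M + r * t) ^ 2) * 1 * (s / 2) * (1 + (M + r * t) ^ 2) ^ (s / 2 - 1) := by
            gcongr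
        _ = s / 2 * ((1 + (M + r * t) ^ 2) ^ (s / 2 - 1) * (1 + (M + r * t) ^ 2)) := by ring
        _ = _ := by
          rw [← Real.rpow_add_one hpos.ne', sub_add_cancel]
    · rw [abs_mul, abs_mul, abs_of_nonneg (Real.exp_pos _).le,
        abs_of_nonneg (Real.rpow_nonneg hpos.le _), abs_neg, abs_mul, abs_mul,
        abs_of_nonneg Real.pi_pos.le, abs_of_nonneg (by norm_num : (0:ℝ) ≤ 2)]
      apply le_of_eq; ring
  have e2 : 1 ≤ Real.exp 1 * Real.exp (t ^ 2) ∧ |t| ≤ Real.exp 1 * Real.exp (t ^ 2) := by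
    rw [← Real.exp_add]
    have := Real.add_one_le_exp (1 + t ^ 2)
    refine ⟨?_, ?_⟩
    · nlinarith [sq_nonneg t]
    · nlinarith [sq_nonneg (|t| - 1), sq_abs t]
  have e3 : Real.exp (t ^ 2) * Real.exp (-(2 * t ^ 2)) = Real.exp (-(t ^ 2)) := by
    rw [← Real.exp_add]; ring_nf
  have e4 : s / 2 + 2 * Real.pi * |t| ≤ (s / 2 + 2 * Real.pi) * (Real.exp 1 * Real.exp (t ^ 2)) := by
    have h5 := mul_le_mul_of_nonneg_left e2.1 (by positivity : 0 ≤ s / 2)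
    have h6 := mul_le_mul_of_nonneg_left e2.2 (by positivity : 0 ≤ 2 * Real.pi)
    linarith
  calc _ ≤ _ := e1
    _ ≤ ((s / 2 + 2 * Real.pi) * (Real.exp 1 * Real.exp (t ^ 2))) *
        (Real.exp (s * |M| + s ^ 2 / 4) * Real.exp (-(2 * t ^ 2))) :=
      mul_le_mul e4 (gG_le hs M r t hr) (gG_nonneg _ _ _ _) (by positivity)
    _ = (s / 2 + 2 * Real.pi) * Real.exp (s * |M| + s ^ 2 / 4) *
      (Real.exp 1 * (Real.exp (t ^ 2) * Real.exp (-(2 * t ^ 2)))) := by ring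
    _ = _ := by rw [e3]

lemma int_gauss {b : ℝ} (hb : 0 < b) : Integrable (fun t : ℝ => Real.exp (-(b * t ^ 2))) := by
  simpa using integrable_exp_neg_mul_sq hb

lemma gG_integrable {s : ℝ} (hs : 0 ≤ s) (M r : ℝ) (hr : |r| ≤ 1) :
    Integrable (gG s M r) := by
  refine ((int_gauss (b := 2) (by norm_num)).const_mul (Real.exp (s * |M| + s ^ 2 / 4))).mono'
    ?_ ?_
  · exact ((gG_cont s M).comp (by fun_prop : Continuous fun t : ℝ => (r, t))).aestronglyMeasurable
  · refine Eventually.of_forall fun t => ?_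
    rw [Real.norm_eq_abs, abs_of_nonneg (gG_nonneg _ _ _ _)]
    exact gG_le hs M r t hr

lemma gG_ee_integrable {s : ℝ} (hs : 0 ≤ s) (M r y : ℝ) (hr : |r| ≤ 1) :
    Integrable (fun t => (gG s M r t : ℂ) * ee (t * y)) := by
  refine (gG_integrable hs M r hr).mono' ?_ ?_
  · refine Continuous.aestronglyMeasurable ?_
    exact (Complex.continuous_ofReal.comp
      ((gG_cont s M).comp (by fun_prop : Continuous fun t : ℝ => (r, t)))).mul
      (continuous_ee.comp (by fun_prop))
  · refine Eventually.of_forall fun t => ?_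
    rw [norm_mul, norm_ee, Complex.norm_real, mul_one, Real.norm_eq_abs,
      abs_of_nonneg (gG_nonneg _ _ _ _)]

lemma AA_fourier (s M r y : ℝ) :
    AA s M r y = FourierTransform.fourier (fun t => (gG s M r t : ℂ)) (-y) := by
  rw [Real.fourier_real_eq_integral_exp_smul]
  unfold AA ee
  congr 1; ext t
  rw [smul_eq_mul, mul_comm]
  congr 2
  push_cast; ring

lemma AA_bound {s : ℝ} (hs : 0 ≤ s) (M : ℝ) :
    ∃ C : ℝ, 0 ≤ C ∧ ∀ r y : ℝ, |r| ≤ 1 → ‖AA s M r y‖ ≤ C * (1 + |y|)⁻¹ := by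
  set C1 : ℝ := ∫ t : ℝ, Real.exp (s * |M| + s ^ 2 / 4) * Real.exp (-(2 * t ^ 2)) with hC1
  set C2 : ℝ := ∫ t : ℝ, (s / 2 + 2 * Real.pi) * Real.exp (s * |M| + s ^ 2 / 4) *
      (Real.exp 1 * Real.exp (-(t ^ 2))) with hC2
  have hC1n : 0 ≤ C1 := integral_nonneg fun t => by positivity
  have hC2n : 0 ≤ C2 := integral_nonneg fun t => by positivity
  have i1 : Integrable fun t : ℝ => (s / 2 + 2 * Real.pi) * Real.exp (s * |M| + s ^ 2 / 4) *
      (Real.exp 1 * Real.exp (-(t ^ 2))) := by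
    have := int_gauss (b := 1) (by norm_num)
    simp only [one_mul] at this
    exact (this.const_mul _).const_mul _
  refine ⟨C1 + C2, by positivity, fun r y hr => ?_⟩
  have b1 : ‖AA s M r y‖ ≤ C1 := by
    unfold AA
    refine norm_integral_le_of_norm_le ((int_gauss (b := 2) (by norm_num)).const_mul _)
      (Eventually.of_forall fun t => ?_)
    rw [norm_mul, norm_ee, Complex.norm_real, mul_one, Real.norm_eq_abs,
      abs_of_nonneg (gG_nonneg _ _ _ _)]
    exact gG_le hs M r t hr
  have hd : ∀ t, HasDerivAt (fun t => (gG s M r t : ℂ)) (gG' s M r t : ℂ) t :=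
    fun t => (gG_hasDeriv s M r t).ofReal_comp
  have hde : deriv (fun t => (gG s M r t : ℂ)) = fun t => (gG' s M r t : ℂ) :=
    funext fun t => (hd t).deriv
  have hbd : ∀ t, ‖(gG' s M r t : ℂ)‖ ≤ (s / 2 + 2 * Real.pi) *
      Real.exp (s * |M| + s ^ 2 / 4) * (Real.exp 1 * Real.exp (-(t ^ 2))) := fun t => by
    rw [Complex.norm_real]; exact gG'_le hs M r t hr
  have hdi : Integrable (deriv fun t => (gG s M r t : ℂ)) := by
    refine i1.mono' (stronglyMeasurable_deriv _).aestronglyMeasurable ?_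
    rw [hde]
    exact Eventually.of_forall hbd
  have hF := congrFun (Real.fourier_deriv (gG_integrable hs M r hr).ofReal
    (fun t => (hd t).differentiableAt) hdi) (-y)
  have hF2 : FourierTransform.fourier (fun t => (gG s M r t : ℂ)) (-y) = AA s M r y :=
    (AA_fourier s M r y).symm
  have b2 : |y| * ‖AA s M r y‖ ≤ C2 := by
    have h1 : ‖FourierTransform.fourier (deriv fun t => (gG s M r t : ℂ)) (-y)‖ ≤ C2 := by
      rw [Real.fourier_real_eq_integral_exp_smul]
      refine norm_integral_le_of_norm_le i1 (Eventually.of_forall fun t => ?_)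
      rw [norm_smul, Complex.norm_exp_ofReal_mul_I, one_mul, hde]
      exact hbd t
    have h2 : ‖FourierTransform.fourier (deriv fun t => (gG s M r t : ℂ)) (-y)‖ =
        2 * Real.pi * |y| * ‖AA s M r y‖ := by
      rw [hF, norm_smul]
      congr 1
      · simp [abs_of_pos Real.pi_pos]
      · rw [← hF2]
    rw [h2] at h1
    have := Real.pi_gt_three
    have h3 : 0 ≤ |y| * ‖AA s M r y‖ := by positivity
    nlinarith
  rw [← div_eq_mul_inv, le_div_iff₀ (by positivity)]
  linarith

lemma AA_cont {s : ℝ} (hs : 0 ≤ s) (M : ℝ) (q : ℝ × ℝ) (hq : |q.1| < 1) :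
    ContinuousAt (fun q : ℝ × ℝ => AA s M q.1 q.2) q := by
  unfold AA
  refine continuousAt_of_dominated
    (bound := fun t : ℝ => Real.exp (s * |M| + s ^ 2 / 4) * Real.exp (-(2 * t ^ 2))) ?_ ?_
    ((int_gauss (b := 2) (by norm_num)).const_mul _) ?_
  · refine Eventually.of_forall fun q => Continuous.aestronglyMeasurable ?_
    exact (Complex.continuous_ofReal.comp
      ((gG_cont s M).comp (by fun_prop : Continuous fun t : ℝ => (q.1, t)))).mul
      (continuous_ee.comp (by fun_prop))
  · have : ∀ᶠ x : ℝ × ℝ in nhds q, |x.1| < 1 :=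
      (by fun_prop : Continuous fun x : ℝ × ℝ => |x.1|).continuousAt.eventually_lt
        continuousAt_const hq
    filter_upwards [this] with x hx
    refine Eventually.of_forall fun t => ?_
    rw [norm_mul, norm_ee, Complex.norm_real, mul_one, Real.norm_eq_abs,
      abs_of_nonneg (gG_nonneg _ _ _ _)]
    exact gG_le hs M _ t hx.le
  · refine Eventually.of_forall fun t => Continuous.continuousAt ?_
    exact (Complex.continuous_ofReal.comp
      ((gG_cont s M).comp (by fun_prop : Continuous fun q : ℝ × ℝ => (q.1, t)))).mul
      (continuous_ee.comp (by fun_prop))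

lemma AA_zero (s M y : ℝ) :
    AA s M 0 y = (((1 + M ^ 2) ^ (s / 2) * Real.exp (-(Real.pi * y ^ 2)) : ℝ) : ℂ) := by
  unfold AA gG ee
  have h := fourierIntegral_gaussian (b := (Real.pi : ℂ)) (by simpa using Real.pi_pos)
    (2 * Real.pi * y)
  have hpi : (Real.pi : ℂ) ≠ 0 := by exact_mod_cast Real.pi_ne_zero
  rw [div_self hpi, Complex.one_cpow, one_mul] at h
  have : ∀ t : ℝ, ((((1 + (M + 0 * t) ^ 2) ^ (s / 2) * Real.exp (-(Real.pi * t ^ 2)) : ℝ)) : ℂ) *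
      Complex.exp (2 * Real.pi * Complex.I * ((t * y : ℝ) : ℂ)) =
      (((1 + M ^ 2) ^ (s / 2) : ℝ) : ℂ) * (Complex.exp (Complex.I * (2 * Real.pi * y) * t) *
        Complex.exp (-Real.pi * t ^ 2)) := by
    intro t
    rw [zero_mul, add_zero, Complex.ofReal_mul, mul_assoc]
    congr 1
    rw [mul_comm, Complex.ofReal_exp]
    congr 2 <;> (push_cast; ring)
  simp_rw [this]
  rw [integral_const_mul, h, Complex.ofReal_mul, Complex.ofReal_exp]
  congr 2
  push_cast
  field_simp
  ring

/-- One dimensional substitution. -/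
lemma one_dim {s : ℝ} (hs : 0 ≤ s) (m : ℤ) (r x : ℝ) (hr : 0 < r) (hr1 : r ≤ 1) :
    Integrable (fun ξ : ℝ => (((1 + ξ ^ 2) ^ (s / 2) *
      (r⁻¹ * Real.exp (-(Real.pi * (r⁻¹ * (ξ - m)) ^ 2))) : ℝ) : ℂ) * ee (ξ * x)) ∧
    ∫ ξ : ℝ, (((1 + ξ ^ 2) ^ (s / 2) *
      (r⁻¹ * Real.exp (-(Real.pi * (r⁻¹ * (ξ - m)) ^ 2))) : ℝ) : ℂ) * ee (ξ * x)
      = ee (m * x) * AA s m r (r * x) := by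
  have hr' : |r| ≤ 1 := by rwa [abs_of_pos hr]
  set G : ℝ → ℂ := fun t => (gG s m r t : ℂ) * ee (t * (r * x)) with hG
  have hGi : Integrable G := gG_ee_integrable hs m r _ hr'
  have key : (fun ξ : ℝ => (((1 + ξ ^ 2) ^ (s / 2) *
      (r⁻¹ * Real.exp (-(Real.pi * (r⁻¹ * (ξ - m)) ^ 2))) : ℝ) : ℂ) * ee (ξ * x)) =
      fun ξ => ((r⁻¹ : ℝ) : ℂ) * ee (m * x) * G (r⁻¹ * (ξ - m)) := by
    ext ξ
    have h1 : (m : ℝ) + r * (r⁻¹ * (ξ - m)) = ξ := by field_simp; ring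
    have h2 : ee (ξ * x) = ee (m * x) * ee (r⁻¹ * (ξ - m) * (r * x)) := by
      rw [← ee_add]; congr 1; field_simp; ring
    simp only [hG, gG, h1, h2]
    push_cast; ring
  rw [key]
  refine ⟨((hGi.comp_mul_left' (inv_ne_zero hr.ne')).comp_sub_right (m : ℝ)).const_mul _, ?_⟩
  rw [integral_const_mul, integral_sub_right_eq_self (fun ξ => G (r⁻¹ * ξ)) (m : ℝ),
    Measure.integral_comp_mul_left, inv_inv, abs_of_pos hr]
  change _ * (r • AA s m r (r * x)) = _
  rw [Complex.real_smul]
  have : (r : ℂ) ≠ 0 := by exact_mod_cast hr.ne'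
  push_cast
  field_simp

/-- Two-dimensional oscillating sum. -/
noncomputable def UU (S : Finset (ℤ × ℤ)) (P : ℤ × ℤ → ℂ) (s r : ℝ) (θ y : ℝ × ℝ) : ℂ :=
  ∑ m ∈ S, P m * ee ((m.1 : ℝ) * θ.1 + (m.2 : ℝ) * θ.2) * (AA s m.1 r y.1 * AA 0 m.2 r y.2)

lemma UU_cont (S : Finset (ℤ × ℤ)) (P : ℤ × ℤ → ℂ) {s : ℝ} (hs : 0 ≤ s) (r : ℝ) (hr : |r| < 1) :
    Continuous (fun q : (ℝ × ℝ) × (ℝ × ℝ) => UU S P s r q.1 q.2) := by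
  unfold UU
  have h : ∀ {s : ℝ}, 0 ≤ s → ∀ M : ℝ, Continuous (fun y => AA s M r y) := by
    intro s hs M
    rw [continuous_iff_continuousAt]
    intro y
    exact ContinuousAt.comp (f := fun y : ℝ => (r, y)) (g := fun q : ℝ × ℝ => AA s M q.1 q.2)
      (AA_cont hs M (r, y) hr) (by fun_prop)
  refine continuous_finsetSum _ fun m _ => ?_
  refine Continuous.mul (continuous_const.mul (continuous_ee.comp (by fun_prop))) ?_
  exact ((h hs _).comp (by fun_prop)).mul ((h le_rfl _).comp (by fun_prop))

lemma UU_cont' (S : Finset (ℤ × ℤ)) (P : ℤ × ℤ → ℂ) {s : ℝ} (hs : 0 ≤ s) (r : ℝ) (hr : |r| < 1)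
    {X : Type*} [TopologicalSpace X] (f g : X → ℝ × ℝ) (hf : Continuous f) (hg : Continuous g) :
    Continuous (fun q : X => UU S P s r (f q) (g q)) :=
  Continuous.comp (g := fun q : (ℝ × ℝ) × (ℝ × ℝ) => UU S P s r q.1 q.2)
    (f := fun q => (f q, g q)) (UU_cont S P hs r hr) (hf.prodMk hg)

lemma UU_bound (S : Finset (ℤ × ℤ)) (P : ℤ × ℤ → ℂ) {s : ℝ} (hs : 0 ≤ s) :
    ∃ K : ℝ, 0 ≤ K ∧ ∀ (r : ℝ) (θ y : ℝ × ℝ), |r| ≤ 1 →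
      ‖UU S P s r θ y‖ ≤ K * ((1 + |y.1|)⁻¹ * (1 + |y.2|)⁻¹) := by
  choose C hC0 hC using fun m : ℤ × ℤ => AA_bound hs (m.1 : ℝ)
  choose D hD0 hD using fun m : ℤ × ℤ => AA_bound le_rfl (m.2 : ℝ)
  refine ⟨∑ m ∈ S, ‖P m‖ * (C m * D m), Finset.sum_nonneg fun m _ =>
    mul_nonneg (norm_nonneg _) (mul_nonneg (hC0 m) (hD0 m)), fun r θ y hr => ?_⟩
  unfold UU
  rw [Finset.sum_mul]
  refine norm_sum_le_of_le _ fun m _ => ?_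
  rw [norm_mul, norm_mul, norm_ee, mul_one, norm_mul, mul_assoc]
  refine mul_le_mul_of_nonneg_left ?_ (norm_nonneg _)
  calc _ ≤ (C m * (1 + |y.1|)⁻¹) * (D m * (1 + |y.2|)⁻¹) :=
        mul_le_mul (hC m r y.1 hr) (hD m r y.2 hr) (norm_nonneg _)
          (mul_nonneg (hC0 m) (by positivity))
    _ = _ := by ring

lemma rpow_sub_tendsto {ι : Type*} {l : Filter ι} {f g : ι → ℝ} {K p : ℝ} (hp : 0 ≤ p)
    (hf : ∀ᶠ i in l, f i ∈ Set.Icc 0 K) (hg : ∀ᶠ i in l, g i ∈ Set.Icc 0 K)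
    (h : Tendsto (fun i => f i - g i) l (nhds 0)) :
    Tendsto (fun i => f i ^ p - g i ^ p) l (nhds 0) := by
  have hu : UniformContinuousOn (fun x : ℝ => x ^ p) (Set.Icc 0 K) :=
    isCompact_Icc.uniformContinuousOn_of_continuous
      (Continuous.continuousOn (Real.continuous_rpow_const hp))
  rw [Metric.uniformContinuousOn_iff] at hu
  rw [Metric.tendsto_nhds] at h ⊢
  intro e he
  obtain ⟨d, hd, hd2⟩ := hu e he
  filter_upwards [hf, hg, h d hd] with i h1 h2 h3
  have := hd2 (f i) h1 (g i) h2 (by rw [Real.dist_eq]; simpa [Real.dist_eq] using h3)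
  rw [Real.dist_eq] at this ⊢
  simpa using this

lemma UU_tendsto (S : Finset (ℤ × ℤ)) (P : ℤ × ℤ → ℂ) {s : ℝ} (hs : 0 ≤ s)
    (θ : ℝ → ℝ × ℝ) (Y : ℝ → ℝ × ℝ) (y : ℝ × ℝ) (hY : Tendsto Y (nhdsWithin 0 (Set.Ioi 0)) (nhds y)) :
    Tendsto (fun r => ‖UU S P s r (θ r) (Y r)‖ - ‖UU S P s 0 (θ r) y‖)
      (nhdsWithin 0 (Set.Ioi 0)) (nhds 0) := by
  have hA : ∀ {s : ℝ}, 0 ≤ s → ∀ (M : ℝ) (Z : ℝ → ℝ) (z : ℝ),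
      Tendsto Z (nhdsWithin 0 (Set.Ioi 0)) (nhds z) →
      Tendsto (fun r => AA s M r (Z r)) (nhdsWithin 0 (Set.Ioi 0)) (nhds (AA s M 0 z)) := by
    intro s hs M Z z hZ
    have h1 : Tendsto (fun r : ℝ => (r, Z r)) (nhdsWithin 0 (Set.Ioi 0)) (nhds ((0:ℝ), z)) :=
      Tendsto.prodMk_nhds (tendsto_nhdsWithin_of_tendsto_nhds tendsto_id) hZ
    have h2 : Tendsto (fun q : ℝ × ℝ => AA s M q.1 q.2) (nhds ((0 : ℝ), z))
        (nhds (AA s M 0 z)) := AA_cont hs M ((0 : ℝ), z) (by simp)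
    exact Tendsto.comp (f := fun r : ℝ => (r, Z r)) h2 h1
  have hY1 : Tendsto (fun r => (Y r).1) (nhdsWithin 0 (Set.Ioi 0)) (nhds y.1) :=
    (continuous_fst.tendsto y).comp hY
  have hY2 : Tendsto (fun r => (Y r).2) (nhdsWithin 0 (Set.Ioi 0)) (nhds y.2) :=
    (continuous_snd.tendsto y).comp hY
  have hB : Tendsto (fun r => ∑ m ∈ S, ‖P m‖ * ‖AA s m.1 r (Y r).1 * AA 0 m.2 r (Y r).2 -
      AA s m.1 0 y.1 * AA 0 m.2 0 y.2‖) (nhdsWithin 0 (Set.Ioi 0)) (nhds 0) := by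
    have : Tendsto (fun r => ∑ m ∈ S, ‖P m‖ * ‖AA s m.1 r (Y r).1 * AA 0 m.2 r (Y r).2 -
      AA s m.1 0 y.1 * AA 0 m.2 0 y.2‖) (nhdsWithin 0 (Set.Ioi 0))
        (nhds (∑ m ∈ S, ‖P m‖ * ‖AA s m.1 0 y.1 * AA 0 m.2 0 y.2 -
      AA s m.1 0 y.1 * AA 0 m.2 0 y.2‖)) := by
      refine tendsto_finsetSum _ fun m _ => ?_
      exact ((((hA hs _ _ _ hY1).mul (hA le_rfl _ _ _ hY2)).sub_const _).norm).const_mul _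
    simpa using this
  refine squeeze_zero_norm (fun r => ?_) hB
  refine (abs_norm_sub_norm_le _ _).trans ?_
  unfold UU
  rw [← Finset.sum_sub_distrib]
  refine norm_sum_le_of_le _ fun m _ => ?_
  rw [← mul_sub, norm_mul, norm_mul, norm_ee, mul_one]

lemma UU_zero (S : Finset (ℤ × ℤ)) (P : ℤ × ℤ → ℂ) (s : ℝ) (θ y : ℝ × ℝ) :
    ‖UU S P s 0 θ y‖ = Real.exp (-(Real.pi * y.1 ^ 2)) * Real.exp (-(Real.pi * y.2 ^ 2)) *
      ‖∑ m ∈ S, (((1 + (m.1 : ℝ) ^ 2) ^ (s / 2) : ℝ) : ℂ) * P m *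
        ee ((m.1 : ℝ) * θ.1 + (m.2 : ℝ) * θ.2)‖ := by
  have : UU S P s 0 θ y =
      ((Real.exp (-(Real.pi * y.1 ^ 2)) * Real.exp (-(Real.pi * y.2 ^ 2)) : ℝ) : ℂ) *
      ∑ m ∈ S, (((1 + (m.1 : ℝ) ^ 2) ^ (s / 2) : ℝ) : ℂ) * P m *
        ee ((m.1 : ℝ) * θ.1 + (m.2 : ℝ) * θ.2) := by
    unfold UU
    rw [Finset.mul_sum]
    refine Finset.sum_congr rfl fun m _ => ?_
    rw [AA_zero, AA_zero, zero_div, Real.rpow_zero]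
    push_cast; ring
  rw [this, norm_mul, Complex.norm_real, Real.norm_of_nonneg (by positivity)]

lemma u_eq (P : ℤ × ℤ → ℂ) (hP : (Function.support P).Finite)
    {s : ℝ} (hs : 0 ≤ s) (r : ℝ) (hr : 0 < r) (hr1 : r ≤ 1) (x : ℝ × ℝ) :
    (∫ ξ : ℝ × ℝ, (((1 + ξ.1 ^ 2) ^ (s / 2) : ℝ) : ℂ) * gaussApprox P (r ^ 2) ξ *
                  Complex.exp (2 * Real.pi * Complex.I *
                    ((ξ.1 * x.1 + ξ.2 * x.2 : ℝ) : ℂ))) = UU hP.toFinset P s r x (r • x) := by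
  set f1 : ℤ → ℝ → ℂ := fun m ξ => (((1 + ξ ^ 2) ^ (s / 2) *
      (r⁻¹ * Real.exp (-(Real.pi * (r⁻¹ * (ξ - m)) ^ 2))) : ℝ) : ℂ) * ee (ξ * x.1) with hf1
  set f2 : ℤ → ℝ → ℂ := fun m ξ => (((1 + ξ ^ 2) ^ ((0:ℝ) / 2) *
      (r⁻¹ * Real.exp (-(Real.pi * (r⁻¹ * (ξ - m)) ^ 2))) : ℝ) : ℂ) * ee (ξ * x.2) with hf2
  have key : ∀ ξ : ℝ × ℝ, (((1 + ξ.1 ^ 2) ^ (s / 2) : ℝ) : ℂ) * gaussApprox P (r ^ 2) ξ *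
                  Complex.exp (2 * Real.pi * Complex.I *
                    ((ξ.1 * x.1 + ξ.2 * x.2 : ℝ) : ℂ)) =
      ∑ m ∈ hP.toFinset, P m * (f1 m.1 ξ.1 * f2 m.2 ξ.2) := by
    intro ξ
    unfold gaussApprox
    rw [tsum_eq_sum (s := hP.toFinset)]
    · rw [Finset.mul_sum, Finset.sum_mul]
      refine Finset.sum_congr rfl fun m _ => ?_
      change _ * _ * ee (ξ.1 * x.1 + ξ.2 * x.2) = _
      rw [ee_add]
      have h1 : (r ^ 2)⁻¹ * Real.exp (-(Real.pi * ((ξ.1 - (m.1 : ℝ)) ^ 2 +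
          (ξ.2 - (m.2 : ℝ)) ^ 2)) / r ^ 2) =
          (r⁻¹ * Real.exp (-(Real.pi * (r⁻¹ * (ξ.1 - m.1)) ^ 2))) *
          (r⁻¹ * Real.exp (-(Real.pi * (r⁻¹ * (ξ.2 - m.2)) ^ 2))) := by
        rw [mul_mul_mul_comm, ← Real.exp_add]
        congr 2
        · field_simp
        · field_simp; ring
      rw [h1]
      simp only [hf1, hf2, zero_div, Real.rpow_zero]
      push_cast; ring
    · intro m hm
      have : P m = 0 := by simpa using hm
      rw [this, zero_mul]
  simp_rw [key]
  rw [integral_finsetSum]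
  · unfold UU
    refine Finset.sum_congr rfl fun m _ => ?_
    rw [integral_const_mul]
    have := integral_prod_mul (μ := (volume : Measure ℝ)) (ν := (volume : Measure ℝ))
      (f1 m.1) (f2 m.2)
    rw [← Measure.volume_eq_prod] at this
    rw [this, (one_dim hs m.1 r x.1 hr hr1).2, (one_dim le_rfl m.2 r x.2 hr hr1).2, ee_add]
    simp only [Prod.smul_fst, Prod.smul_snd, smul_eq_mul]
    ring
  · intro m _
    refine Integrable.const_mul ?_ _
    rw [Measure.volume_eq_prod]
    exact (one_dim hs m.1 r x.1 hr hr1).1.mul_prod (one_dim le_rfl m.2 r x.2 hr hr1).1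

lemma periodic_sq (H : ℝ × ℝ → ℝ) (hH : Continuous H)
    (h1 : ∀ a b, H (a + 1, b) = H (a, b)) (h2 : ∀ a b, H (a, b + 1) = H (a, b)) (a : ℝ × ℝ) :
    ∫ z in Set.Icc (0 : ℝ) 1 ×ˢ Set.Icc (0 : ℝ) 1, H (a + z) =
    ∫ z in Set.Icc (0 : ℝ) 1 ×ˢ Set.Icc (0 : ℝ) 1, H z := by
  have one : ∀ (f : ℝ → ℝ) (hf : Function.Periodic f 1) (c : ℝ),
      ∫ z in Set.Icc (0 : ℝ) 1, f (c + z) = ∫ z in Set.Icc (0 : ℝ) 1, f z := by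
    intro f hf c
    rw [integral_Icc_eq_integral_Ioc, integral_Icc_eq_integral_Ioc,
      ← intervalIntegral.integral_of_le zero_le_one, ← intervalIntegral.integral_of_le zero_le_one,
      intervalIntegral.integral_comp_add_left, add_zero, hf.intervalIntegral_add_eq c 0, zero_add]
  have hc : IsCompact (Set.Icc (0 : ℝ) 1 ×ˢ Set.Icc (0 : ℝ) 1) := isCompact_Icc.prod isCompact_Icc
  rw [Measure.volume_eq_prod, setIntegral_prod, setIntegral_prod]
  · have e1 : ∀ u v : ℝ, a + (u, v) = (a.1 + u, a.2 + v) := fun u v => rfl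
    simp_rw [e1]
    have e2 : ∀ u : ℝ, ∫ v in Set.Icc (0 : ℝ) 1, H (a.1 + u, a.2 + v) =
        ∫ v in Set.Icc (0 : ℝ) 1, H (a.1 + u, v) := fun u =>
      one (fun v => H (a.1 + u, v)) (fun v => h2 _ v) a.2
    simp_rw [e2]
    refine one (fun u => ∫ v in Set.Icc (0 : ℝ) 1, H (u, v)) (fun u => ?_) a.1
    simp only [h1]
  · exact hH.continuousOn.integrableOn_compact hc
  · exact (by fun_prop : Continuous fun z => H (a + z)).continuousOn.integrableOn_compact hc

lemma integrable_dom {p : ℝ} (hp : 2 ≤ p) (K : ℝ) (hK : 0 ≤ K) :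
    Integrable (fun y : ℝ × ℝ => (K * ((1 + |y.1|)⁻¹ * (1 + |y.2|)⁻¹)) ^ p) := by
  have h1 : Integrable (fun y : ℝ => (1 + |y|) ^ (-p)) := by
    have := integrable_one_add_norm (E := ℝ) (μ := volume) (r := p)
      (by rw [Module.finrank_self]; push_cast; linarith)
    simpa using this
  have h2 := (h1.mul_prod h1).const_mul (K ^ p)
  rw [← Measure.volume_eq_prod] at h2
  refine h2.congr (Eventually.of_forall fun y => ?_)
  simp only
  have a1 : 0 ≤ 1 + |y.1| := by positivity
  have a2 : 0 ≤ 1 + |y.2| := by positivity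
  rw [Real.mul_rpow hK (by positivity), Real.mul_rpow (by positivity) (by positivity),
    Real.inv_rpow a1, Real.inv_rpow a2, Real.rpow_neg a1, Real.rpow_neg a2]

lemma shift_le (y r z : ℝ) (hr : |r| ≤ 1) (hz : z ∈ Set.Icc (0 : ℝ) 1) :
    (1 + |y + r * z|)⁻¹ ≤ 2 * (1 + |y|)⁻¹ := by
  have h1 : |r * z| ≤ 1 := by
    rw [abs_mul, abs_of_nonneg hz.1]; nlinarith [abs_nonneg r, hz.1, hz.2]
  have h2 : |y| ≤ |y + r * z| + |r * z| := by
    have := abs_sub (y + r * z) (r * z)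
    simpa using this
  rw [← div_eq_mul_inv, le_div_iff₀ (by positivity), inv_mul_le_iff₀ (by positivity)]
  linarith [abs_nonneg (y + r * z)]

lemma int_exp_p {p : ℝ} (hp : 0 < p) :
    ∫ y : ℝ × ℝ, (Real.exp (-(Real.pi * y.1 ^ 2)) * Real.exp (-(Real.pi * y.2 ^ 2))) ^ p = 1 / p := by
  have h : ∀ y : ℝ × ℝ, (Real.exp (-(Real.pi * y.1 ^ 2)) * Real.exp (-(Real.pi * y.2 ^ 2))) ^ p =
      Real.exp (-(Real.pi * p) * y.1 ^ 2) * Real.exp (-(Real.pi * p) * y.2 ^ 2) := by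
    intro y
    rw [← Real.exp_add, ← Real.exp_mul, ← Real.exp_add]; ring_nf
  simp_rw [h]
  have := integral_prod_mul (μ := (volume : Measure ℝ)) (ν := (volume : Measure ℝ))
    (fun t : ℝ => Real.exp (-(Real.pi * p) * t ^ 2)) (fun t : ℝ => Real.exp (-(Real.pi * p) * t ^ 2))
  rw [← Measure.volume_eq_prod] at this
  rw [this, integral_gaussian, Real.mul_self_sqrt (by positivity)]
  have := Real.pi_pos
  field_simp

lemma main_lim_s12 (S : Finset (ℤ × ℤ)) (P : ℤ × ℤ → ℂ) {s : ℝ} (hs : 0 ≤ s) {p : ℝ} (hp : 2 ≤ p) :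
    Tendsto (fun r : ℝ => ∫ y : ℝ × ℝ, ‖UU S P s r (r⁻¹ • y) y‖ ^ p)
      (nhdsWithin 0 (Set.Ioi 0))
      (nhds (1 / p * ∫ z in Set.Icc (0 : ℝ) 1 ×ˢ Set.Icc (0 : ℝ) 1,
        ‖∑ m ∈ S, (((1 + (m.1 : ℝ) ^ 2) ^ (s / 2) : ℝ) : ℂ) * P m *
        ee ((m.1 : ℝ) * z.1 + (m.2 : ℝ) * z.2)‖ ^ p)) := by
  have hp0 : 0 < p := by linarith
  set Q : ℝ × ℝ → ℂ := fun z => ∑ m ∈ S, (((1 + (m.1 : ℝ) ^ 2) ^ (s / 2) : ℝ) : ℂ) * P m *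
        ee ((m.1 : ℝ) * z.1 + (m.2 : ℝ) * z.2) with hQ
  have hQc : Continuous Q := by
    refine continuous_finsetSum _ fun m _ => ?_
    exact continuous_const.mul (continuous_ee.comp (by fun_prop))
  set sq : Set (ℝ × ℝ) := Set.Icc (0 : ℝ) 1 ×ˢ Set.Icc (0 : ℝ) 1 with hsq
  have hsqm : MeasurableSet sq := measurableSet_Icc.prod measurableSet_Icc
  have hvol : (volume : Measure (ℝ × ℝ)) sq = 1 := by
    rw [hsq, Measure.volume_eq_prod, Measure.prod_prod]; simp
  set ν : Measure (ℝ × ℝ) := volume.restrict sq with hν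
  have : IsProbabilityMeasure ν := ⟨by rw [hν, Measure.restrict_apply_univ, hvol]⟩
  set μ : Measure ((ℝ × ℝ) × (ℝ × ℝ)) := (volume : Measure (ℝ × ℝ)).prod ν with hμ
  obtain ⟨K, hK0, hK⟩ := UU_bound S P hs
  set G : ℝ × ℝ → ℝ := fun y => ((4 * K) * ((1 + |y.1|)⁻¹ * (1 + |y.2|)⁻¹)) ^ p with hG
  have hGi : Integrable (fun q : (ℝ × ℝ) × (ℝ × ℝ) => G q.1) μ :=
    (integrable_dom hp (4 * K) (by positivity)).comp_fst ν
  have hae : ∀ᵐ q ∂μ, q.2 ∈ sq := by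
    have h1 : ∀ᵐ z ∂ν, z ∈ sq := ae_restrict_mem hsqm
    exact Measure.quasiMeasurePreserving_snd.ae h1
  -- pointwise bounds
  have bd1 : ∀ (r : ℝ) (θ y z : ℝ × ℝ), |r| ≤ 1 → z ∈ sq →
      ‖UU S P s r θ (y + r • z)‖ ≤ (4 * K) * ((1 + |y.1|)⁻¹ * (1 + |y.2|)⁻¹) := by
    intro r θ y z hr hz
    have h1 := shift_le y.1 r z.1 hr hz.1
    have h2 := shift_le y.2 r z.2 hr hz.2
    calc _ ≤ _ := hK r θ _ hr
      _ ≤ K * ((2 * (1 + |y.1|)⁻¹) * (2 * (1 + |y.2|)⁻¹)) := by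
        refine mul_le_mul_of_nonneg_left ?_ hK0
        exact mul_le_mul h1 h2 (by positivity) (by positivity)
      _ = _ := by ring
  have bd0 : ∀ (θ y : ℝ × ℝ),
      ‖UU S P s 0 θ y‖ ≤ (4 * K) * ((1 + |y.1|)⁻¹ * (1 + |y.2|)⁻¹) := by
    intro θ y
    refine (hK 0 θ y (by simp)).trans ?_
    refine mul_le_mul_of_nonneg_right (by linarith) (by positivity)
  set F1 : ℝ → (ℝ × ℝ) × (ℝ × ℝ) → ℝ := fun r q =>
    ‖UU S P s r (r⁻¹ • q.1 + q.2) (q.1 + r • q.2)‖ ^ p with hF1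
  set F0 : ℝ → (ℝ × ℝ) × (ℝ × ℝ) → ℝ := fun r q =>
    ‖UU S P s 0 (r⁻¹ • q.1 + q.2) q.1‖ ^ p with hF0
  have hF1c : ∀ r, |r| < 1 → Continuous (F1 r) := by
    intro r hr
    refine Continuous.rpow_const (Continuous.norm ?_) (fun _ => Or.inr hp0.le)
    exact UU_cont' S P hs r hr (fun q : (ℝ × ℝ) × (ℝ × ℝ) => r⁻¹ • q.1 + q.2)
      (fun q => q.1 + r • q.2) (by fun_prop) (by fun_prop)
  have hF0c : ∀ r, Continuous (F0 r) := by
    intro r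
    refine Continuous.rpow_const (Continuous.norm ?_) (fun _ => Or.inr hp0.le)
    exact UU_cont' S P hs 0 (by simp) (fun q : (ℝ × ℝ) × (ℝ × ℝ) => r⁻¹ • q.1 + q.2)
      (fun q => q.1) (by fun_prop) (by fun_prop)
  have hF1b : ∀ r, |r| < 1 → ∀ᵐ q ∂μ, ‖F1 r q‖ ≤ G q.1 := by
    intro r hr
    filter_upwards [hae] with q hq
    rw [Real.norm_of_nonneg (by positivity)]
    exact Real.rpow_le_rpow (norm_nonneg _) (bd1 r _ _ _ hr.le hq) hp0.le
  have hF0b : ∀ r, ∀ q, ‖F0 r q‖ ≤ G q.1 := by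
    intro r q
    rw [Real.norm_of_nonneg (by positivity)]
    exact Real.rpow_le_rpow (norm_nonneg _) (bd0 _ _) hp0.le
  have hF1i : ∀ r, |r| < 1 → Integrable (F1 r) μ := fun r hr =>
    hGi.mono' (hF1c r hr).aestronglyMeasurable (hF1b r hr)
  have hF0i : ∀ r, Integrable (F0 r) μ := fun r =>
    hGi.mono' (hF0c r).aestronglyMeasurable (Eventually.of_forall (hF0b r))
  have hsmall : ∀ᶠ r : ℝ in nhdsWithin 0 (Set.Ioi 0), 0 < r ∧ r < 1 := by
    filter_upwards [Ioo_mem_nhdsGT (zero_lt_one (α := ℝ))] with r hr using hr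
  -- first identity
  have id1 : ∀ r : ℝ, 0 < r → r < 1 →
      ∫ y : ℝ × ℝ, ‖UU S P s r (r⁻¹ • y) y‖ ^ p = ∫ q, F1 r q ∂μ := by
    intro r hr hr1
    rw [hμ, integral_prod_symm _ (hF1i r (by rwa [abs_of_pos hr]))]
    have : ∀ z : ℝ × ℝ, ∫ y, F1 r (y, z) = ∫ y : ℝ × ℝ, ‖UU S P s r (r⁻¹ • y) y‖ ^ p := by
      intro z
      rw [← integral_add_right_eq_self (fun y : ℝ × ℝ => ‖UU S P s r (r⁻¹ • y) y‖ ^ p) (r • z)]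
      simp only [hF1, smul_add, smul_smul, inv_mul_cancel₀ hr.ne', one_smul]
    simp_rw [this]
    simp
  have id0 : ∀ r : ℝ, ∫ q, F0 r q ∂μ = 1 / p * ∫ z in sq, ‖Q z‖ ^ p := by
    intro r
    rw [hμ, integral_prod _ (hF0i r)]
    have : ∀ y : ℝ × ℝ, ∫ z, F0 r (y, z) ∂ν =
        (Real.exp (-(Real.pi * y.1 ^ 2)) * Real.exp (-(Real.pi * y.2 ^ 2))) ^ p *
          ∫ z in sq, ‖Q z‖ ^ p := by
      intro y
      rw [← periodic_sq (fun z => ‖Q z‖ ^ p)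
        (Continuous.rpow_const hQc.norm (fun _ => Or.inr hp0.le)) ?_ ?_ (r⁻¹ • y),
        ← integral_const_mul]
      · refine integral_congr_ae (Eventually.of_forall fun z => ?_)
        simp only [hF0]
        rw [UU_zero, Real.mul_rpow (by positivity) (norm_nonneg _)]
      · intro a b
        have : Q (a + 1, b) = Q (a, b) := by
          refine Finset.sum_congr rfl fun m _ => ?_
          congr 1
          rw [show (m.1 : ℝ) * (a + 1) + m.2 * b = (m.1 * a + m.2 * b) + (m.1 : ℝ) by ring,
            ee_add, ee_int, mul_one]
        simp only [this]
      · intro a b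
        have : Q (a, b + 1) = Q (a, b) := by
          refine Finset.sum_congr rfl fun m _ => ?_
          congr 1
          rw [show (m.1 : ℝ) * a + m.2 * (b + 1) = (m.1 * a + m.2 * b) + (m.2 : ℝ) by ring,
            ee_add, ee_int, mul_one]
        simp only [this]
    simp_rw [this]
    rw [integral_mul_const, int_exp_p hp0]
  have lim : Tendsto (fun r => ∫ q, (F1 r q - F0 r q) ∂μ) (nhdsWithin 0 (Set.Ioi 0)) (nhds 0) := by
    have := tendsto_integral_filter_of_dominated_convergence (μ := μ)
      (l := nhdsWithin (0:ℝ) (Set.Ioi 0)) (F := fun r q => F1 r q - F0 r q) (f := fun _ => (0:ℝ))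
      (fun q => G q.1 + G q.1) ?_ ?_ (hGi.add hGi) ?_
    · simpa using this
    · filter_upwards [hsmall] with r hr
      exact ((hF1c r (by rw [abs_of_pos hr.1]; exact hr.2)).sub (hF0c r)).aestronglyMeasurable
    · filter_upwards [hsmall] with r hr
      filter_upwards [hF1b r (by rw [abs_of_pos hr.1]; exact hr.2)] with q hq
      exact (norm_sub_le _ _).trans (add_le_add hq (hF0b r q))
    · filter_upwards [hae] with q hq
      refine rpow_sub_tendsto (K := (4 * K) * ((1 + |q.1.1|)⁻¹ * (1 + |q.1.2|)⁻¹)) hp0.le ?_ ?_ ?_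
      · filter_upwards [hsmall] with r hr
        exact ⟨norm_nonneg _, bd1 r _ _ _ (by rw [abs_of_pos hr.1]; exact hr.2.le) hq⟩
      · exact Eventually.of_forall fun r => ⟨norm_nonneg _, bd0 _ _⟩
      · refine UU_tendsto S P hs (fun r => r⁻¹ • q.1 + q.2) (fun r => q.1 + r • q.2) q.1 ?_
        have hc : Continuous fun r : ℝ => q.1 + r • q.2 := by fun_prop
        have := hc.tendsto 0
        simp only [zero_smul, add_zero] at this
        exact tendsto_nhdsWithin_of_tendsto_nhds this
  have lim2 := lim.add_const (1 / p * ∫ z in sq, ‖Q z‖ ^ p)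
  rw [zero_add] at lim2
  refine lim2.congr' ?_
  filter_upwards [hsmall] with r hr
  rw [integral_sub (hF1i r (by rw [abs_of_pos hr.1]; exact hr.2)) (hF0i r), id0 r,
    id1 r hr.1 hr.2]
  ring

/-- Lemma 3.7: for a trigonometric polynomial `P`, `s ≥ 0`,
`α > 0`, `2 ≤ p < ∞`, setting `u_ε = ⟨∂₁⟩^s (P·w_{αε})` (written via its Fourier
representation), one has
`ε^{1/p} ‖u_ε‖_{L^p(ℝ²)} → (pα)^{−1/p} ‖⟨∂₁⟩^s P‖_{L^p([0,1]²)}` as `ε → 0⁺`. -/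
theorem stmt_12 (P : ℤ × ℤ → ℂ) (hP : (Function.support P).Finite)
    (s : ℝ) (hs : 0 ≤ s) (α : ℝ) (hα : 0 < α) (p : ℝ) (hp : 2 ≤ p) :
    Tendsto
      (fun ε : ℝ => ε ^ ((1 : ℝ) / p) *
        (∫ x : ℝ × ℝ,
            ‖∫ ξ : ℝ × ℝ,
                (((1 + ξ.1 ^ 2) ^ (s / 2) : ℝ) : ℂ) * gaussApprox P (α * ε) ξ *
                  Complex.exp (2 * Real.pi * Complex.I *
                    ((ξ.1 * x.1 + ξ.2 * x.2 : ℝ) : ℂ))‖ ^ p) ^ ((1 : ℝ) / p))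
      (nhdsWithin 0 (Set.Ioi 0))
      (nhds ((p * α) ^ (-((1 : ℝ) / p)) *
        (∫ x in Set.Icc (0 : ℝ) 1 ×ˢ Set.Icc (0 : ℝ) 1,
            ‖∑' m : ℤ × ℤ,
                (((1 + (m.1 : ℝ) ^ 2) ^ (s / 2) : ℝ) : ℂ) * P m *
                  Complex.exp (2 * Real.pi * Complex.I *
                    (((m.1 : ℝ) * x.1 + (m.2 : ℝ) * x.2 : ℝ) : ℂ))‖ ^ p) ^ ((1 : ℝ) / p))) := by

  have hp0 : 0 < p := by linarith
  have hQ : ∀ x : ℝ × ℝ, (∑' m : ℤ × ℤ,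
                (((1 + (m.1 : ℝ) ^ 2) ^ (s / 2) : ℝ) : ℂ) * P m *
                  Complex.exp (2 * Real.pi * Complex.I *
                    (((m.1 : ℝ) * x.1 + (m.2 : ℝ) * x.2 : ℝ) : ℂ))) =
      ∑ m ∈ hP.toFinset, (((1 + (m.1 : ℝ) ^ 2) ^ (s / 2) : ℝ) : ℂ) * P m *
        ee ((m.1 : ℝ) * x.1 + (m.2 : ℝ) * x.2) := by
    intro x
    rw [tsum_eq_sum (s := hP.toFinset)]
    · rfl
    · intro m hm
      have : P m = 0 := by simpa using hm
      rw [this, mul_zero, zero_mul]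
  simp_rw [hQ]
  set I : ℝ := ∫ z in Set.Icc (0 : ℝ) 1 ×ˢ Set.Icc (0 : ℝ) 1,
        ‖∑ m ∈ hP.toFinset, (((1 + (m.1 : ℝ) ^ 2) ^ (s / 2) : ℝ) : ℂ) * P m *
        ee ((m.1 : ℝ) * z.1 + (m.2 : ℝ) * z.2)‖ ^ p with hI
  have hI0 : 0 ≤ I := integral_nonneg fun z => by positivity
  have hr : Tendsto (fun ε : ℝ => √(α * ε)) (nhdsWithin 0 (Set.Ioi 0))
      (nhdsWithin 0 (Set.Ioi 0)) := by
    refine tendsto_nhdsWithin_iff.mpr ⟨?_, ?_⟩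
    · have hc : Continuous fun ε : ℝ => √(α * ε) := by fun_prop
      have := hc.tendsto 0
      simp only [mul_zero, Real.sqrt_zero] at this
      exact tendsto_nhdsWithin_of_tendsto_nhds this
    · filter_upwards [self_mem_nhdsWithin] with ε hε
      exact Real.sqrt_pos.mpr (mul_pos hα hε)
  have hsmall : ∀ᶠ r : ℝ in nhdsWithin 0 (Set.Ioi 0), 0 < r ∧ r < 1 := by
    filter_upwards [Ioo_mem_nhdsGT (zero_lt_one (α := ℝ))] with r hr using hr
  have hlim := (((main_lim_s12 hP.toFinset P hs hp).comp hr).const_mul (1 / α)).rpow_const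
    (p := 1 / p) (Or.inr (by positivity))
  rw [← hI] at hlim
  have hfin : (1 / α * (1 / p * I)) ^ (1 / p) = (p * α) ^ (-(1 / p)) * I ^ (1 / p) := by
    rw [Real.rpow_neg (by positivity), ← Real.inv_rpow (by positivity),
      ← Real.mul_rpow (by positivity) hI0]
    congr 1
    field_simp
  rw [hfin] at hlim
  refine hlim.congr' ?_
  filter_upwards [self_mem_nhdsWithin, hr.eventually hsmall] with ε hε hrε
  have hε0 : (0 : ℝ) < ε := hε
  set r : ℝ := √(α * ε) with hrdef
  have hr2 : α * ε = r ^ 2 := (Real.sq_sqrt (by positivity)).symm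
  simp only [Function.comp]
  rw [← hrdef, hr2]
  simp_rw [u_eq P hP hs r hrε.1 hrε.2.le]
  have hsc := Measure.integral_comp_smul (volume : Measure (ℝ × ℝ))
    (fun y => ‖UU hP.toFinset P s r (r⁻¹ • y) y‖ ^ p) r
  simp only [smul_smul, inv_mul_cancel₀ hrε.1.ne', one_smul] at hsc
  rw [hsc, ← Real.mul_rpow hε0.le]
  · congr 1
    have : Module.finrank ℝ (ℝ × ℝ) = 2 := by simp
    rw [this, abs_of_pos (by have := hrε.1; positivity), ← hr2, smul_eq_mul]
    field_simp
  · exact smul_nonneg (abs_nonneg _) (integral_nonneg fun y => by positivity)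
end
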